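/- arXiv:1910.12280 — 4 statements merged into one kernel-verified Lean document; each statement's English description precedes it below -/
import Mathlib

section
/- Let R be a principal ideal domain, N ∈ R nonzero and not a unit, R̄ = R/NR, S = R̄[x_1,…,x_n] with a fixed monomial order, and I an ideal of S. If I admits a Gröbner basis {f_1,…,f_m} all of whose leading coefficients lc(f_i) are nonzerodivisors in R̄, then there exist p ≤ n+1, finitely generated free S-modules F_0,…,F_p, and an exact sequence 0 → F_p → F_{p−1} → ⋯ → F_0 → S/I → 0 of S-modules. -/
open MvPolynomial
open scoped MonomialOrder

namespace PaperGB

variable {n : ℕ} {R : Type*} [CommSemiring R]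

/-- The degree (leading exponent) of a multivariate polynomial w.r.t. a monomial order. -/
noncomputable def mDeg (m : MonomialOrder (Fin n)) (f : MvPolynomial (Fin n) R) :
    Fin n →₀ ℕ :=
  m.toSyn.symm (f.support.sup fun d => m.toSyn d)

/-- The leading coefficient. -/
noncomputable def mLC (m : MonomialOrder (Fin n)) (f : MvPolynomial (Fin n) R) : R :=
  f.coeff (mDeg m f)

/-- The leading term. -/
noncomputable def mLT (m : MonomialOrder (Fin n)) (f : MvPolynomial (Fin n) R) :
    MvPolynomial (Fin n) R :=
  monomial (mDeg m f) (mLC m f)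

variable {R : Type*} [CommRing R]

/-- The leading term ideal. -/
noncomputable def mLTIdeal (m : MonomialOrder (Fin n)) (I : Ideal (MvPolynomial (Fin n) R)) :
    Ideal (MvPolynomial (Fin n) R) :=
  Ideal.span ((fun g => mLT m g) '' {g | g ∈ I ∧ g ≠ 0})

/-- `f` is a Gröbner basis of `I`. -/
def IsGroebnerBasis (m : MonomialOrder (Fin n)) (I : Ideal (MvPolynomial (Fin n) R))
    {k : ℕ} (f : Fin k → MvPolynomial (Fin n) R) : Prop :=
  (∀ i, f i ≠ 0) ∧ (∀ i, f i ∈ I) ∧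
    Ideal.span (Set.range fun i => mLT m (f i)) = mLTIdeal m I

/-- `g` reduces to zero modulo the family `f`. -/
def ReducesToZero (m : MonomialOrder (Fin n)) {k : ℕ} (f : Fin k → MvPolynomial (Fin n) R)
    (g : MvPolynomial (Fin n) R) : Prop :=
  ∃ p : Fin k → MvPolynomial (Fin n) R,
    g = ∑ i, p i * f i ∧
    ∀ i, p i * f i ≠ 0 → mDeg m (p i) + mDeg m (f i) ≼[m] mDeg m g

/-- A weakly regular sequence. -/
def IsWeakRegularSeq {k : ℕ} (s : Fin k → R) : Prop :=
  ∀ i : Fin k, ∀ x : R,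
    s i * x ∈ Ideal.span (s '' {j | j < i}) → x ∈ Ideal.span (s '' {j | j < i})

/-- A permutable weak regular sequence of non-units. -/
def IsPermutableWeakRegularSeq {k : ℕ} (s : Fin k → R) : Prop :=
  (∀ i, ¬ IsUnit (s i)) ∧ ∀ σ : Equiv.Perm (Fin k), IsWeakRegularSeq (s ∘ σ)

/-- `M` has a free resolution `0 → F_p → ⋯ → F_0 → M → 0` by finitely generated
free `S`-modules. -/
def HasFiniteFreeResolutionOfLength (S : Type*) [CommRing S] (M : Type*) [AddCommGroup M]
    [Module S M] (p : ℕ) : Prop :=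
  ∃ (d : ℕ → ℕ) (g : ∀ i : ℕ, (Fin (d (i + 1)) → S) →ₗ[S] (Fin (d i) → S))
    (ε : (Fin (d 0) → S) →ₗ[S] M),
    (∀ i, p < i → d i = 0) ∧
    Function.Surjective ε ∧
    LinearMap.range (g 0) = LinearMap.ker ε ∧
    ∀ i, LinearMap.range (g (i + 1)) = LinearMap.ker (g i)

/-- `M` has an infinite free resolution `⋯ → F_p → F_p → F_p → F_{p-1} → ⋯ → F_0 → M → 0`
by finitely generated free `S`-modules, whose modules are constant from stage `p` on. -/
def HasEventuallyConstantFreeResolution (S : Type*) [CommRing S] (M : Type*) [AddCommGroup M]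
    [Module S M] (p : ℕ) : Prop :=
  ∃ (d : ℕ → ℕ) (g : ∀ i : ℕ, (Fin (d (i + 1)) → S) →ₗ[S] (Fin (d i) → S))
    (ε : (Fin (d 0) → S) →ₗ[S] M),
    (∀ i, p ≤ i → d i = d p) ∧
    Function.Surjective ε ∧
    LinearMap.range (g 0) = LinearMap.ker ε ∧
    ∀ i, LinearMap.range (g (i + 1)) = LinearMap.ker (g i)

end PaperGB

open PaperGB

namespace ModuleGroebner

section

variable {n : ℕ} {A : Type*} [CommRing A] {r : ℕ}

/-- The key by which the monomials `x ^ a • e i` of a free module are compared: first the monomial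
`x ^ (a + w i)`, where `w i` is the weight of the basis vector `e i`; ties are won by the smaller
index. -/
noncomputable def key (m : MonomialOrder (Fin n)) (w : Fin r → Fin n →₀ ℕ) (i : Fin r)
    (a : Fin n →₀ ℕ) : m.syn ×ₗ (Fin r)ᵒᵈ :=
  toLex (m.toSyn (a + w i), OrderDual.toDual i)

variable {m : MonomialOrder (Fin n)} {w : Fin r → Fin n →₀ ℕ}

theorem key_le_iff {i j : Fin r} {a b : Fin n →₀ ℕ} :
    key m w i a ≤ key m w j b ↔
      m.toSyn (a + w i) < m.toSyn (b + w j) ∨ a + w i = b + w j ∧ j ≤ i := by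
  rw [Prod.Lex.le_iff]
  simp only [key, ofLex_toLex, OrderDual.toDual_le_toDual, EmbeddingLike.apply_eq_iff_eq]

theorem key_lt_iff {i j : Fin r} {a b : Fin n →₀ ℕ} :
    key m w i a < key m w j b ↔
      m.toSyn (a + w i) < m.toSyn (b + w j) ∨ a + w i = b + w j ∧ j < i := by
  rw [Prod.Lex.lt_iff]
  simp only [key, ofLex_toLex, OrderDual.toDual_lt_toDual, EmbeddingLike.apply_eq_iff_eq]

theorem key_inj {i j : Fin r} {a b : Fin n →₀ ℕ} (h : key m w i a = key m w j b) :
    i = j ∧ a = b := by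
  have h1 := congrArg (fun x => (ofLex x).1) h
  have h2 := congrArg (fun x => OrderDual.ofDual (ofLex x).2) h
  simp only [key, ofLex_toLex, EmbeddingLike.apply_eq_iff_eq, OrderDual.ofDual_toDual] at h1 h2
  subst h2
  exact ⟨rfl, add_right_cancel h1⟩

theorem key_add_le {i j : Fin r} {a b : Fin n →₀ ℕ} (h : key m w i a ≤ key m w j b)
    (d : Fin n →₀ ℕ) : key m w i (a + d) ≤ key m w j (b + d) := by
  rw [key_le_iff] at h ⊢
  rw [add_right_comm, add_right_comm b]
  simpa using h

/-- `x ^ a • e i` is the leading monomial of `h`. -/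
def IsLead (m : MonomialOrder (Fin n)) (w : Fin r → Fin n →₀ ℕ)
    (h : Fin r → MvPolynomial (Fin n) A) (i : Fin r) (a : Fin n →₀ ℕ) : Prop :=
  coeff a (h i) ≠ 0 ∧ ∀ j b, coeff b (h j) ≠ 0 → key m w j b ≤ key m w i a

theorem exists_isLead (m : MonomialOrder (Fin n)) (w : Fin r → Fin n →₀ ℕ)
    {h : Fin r → MvPolynomial (Fin n) A} (hh : h ≠ 0) : ∃ i a, IsLead m w h i a := by
  obtain ⟨i, hi⟩ := Function.ne_iff.1 hh
  obtain ⟨a, ha⟩ := MvPolynomial.ne_zero_iff.1 hi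
  obtain ⟨x, hx, hmax⟩ := Finset.exists_max_image
    (Finset.univ.sigma fun j => (h j).support) (fun x => key m w x.1 x.2)
    ⟨⟨i, a⟩, by simpa using ha⟩
  refine ⟨x.1, x.2, by simpa using hx, fun j b hb => hmax ⟨j, b⟩ (by simpa using hb)⟩

/-- The family `g` is a Gröbner basis of the submodule `K`, and `g k` is monic with leading monomial
`x ^ α k • e (c k)`. -/
structure MonicGB {ι : Type*} (m : MonomialOrder (Fin n)) (w : Fin r → Fin n →₀ ℕ)
    (K : Submodule (MvPolynomial (Fin n) A) (Fin r → MvPolynomial (Fin n) A))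
    (g : ι → Fin r → MvPolynomial (Fin n) A) (c : ι → Fin r) (α : ι → Fin n →₀ ℕ) : Prop where
  mem : ∀ k, g k ∈ K
  coeff_eq : ∀ k, coeff (α k) (g k (c k)) = 1
  le : ∀ k j b, coeff b (g k j) ≠ 0 → key m w j b ≤ key m w (c k) (α k)
  div : ∀ h ∈ K, ∀ i a, IsLead m w h i a → ∃ k, c k = i ∧ α k ≤ a

namespace MonicGB

variable {K : Submodule (MvPolynomial (Fin n) A) (Fin r → MvPolynomial (Fin n) A)}

theorem comp_equiv {ι κ : Type*} {g : ι → Fin r → MvPolynomial (Fin n) A} {c : ι → Fin r}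
    {α : ι → Fin n →₀ ℕ} (G : MonicGB m w K g c α) (e : κ ≃ ι) :
    MonicGB m w K (g ∘ e) (c ∘ e) (α ∘ e) where
  mem k := G.mem _
  coeff_eq k := G.coeff_eq _
  le k := G.le _
  div h hh i a hl := by
    obtain ⟨k, hk⟩ := G.div h hh i a hl
    exact ⟨e.symm k, by simpa using hk⟩

theorem coeff_monomial_smul_le {ι : Type*} {g : ι → Fin r → MvPolynomial (Fin n) A}
    {c : ι → Fin r} {α : ι → Fin n →₀ ℕ} (G : MonicGB m w K g c α) (k : ι) (d : Fin n →₀ ℕ) (u : A)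
    {j : Fin r} {b : Fin n →₀ ℕ} (hb : coeff b ((monomial d u • g k) j) ≠ 0) :
    key m w j b ≤ key m w (c k) (α k + d) := by
  rw [Pi.smul_apply, smul_eq_mul, coeff_monomial_mul'] at hb
  split_ifs at hb with hd
  · have := key_add_le (G.le k j _ (right_ne_zero_of_mul hb)) d
    rwa [tsub_add_cancel_of_le hd] at this
  · exact absurd rfl hb

theorem coeff_monomial_smul_lead {ι : Type*} {g : ι → Fin r → MvPolynomial (Fin n) A}
    {c : ι → Fin r} {α : ι → Fin n →₀ ℕ} (G : MonicGB m w K g c α) (k : ι) (d : Fin n →₀ ℕ)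
    (u : A) : coeff (α k + d) ((monomial d u • g k) (c k)) = u := by
  rw [Pi.smul_apply, smul_eq_mul, add_comm, coeff_monomial_mul, G.coeff_eq, mul_one]

variable {s : ℕ} {g : Fin s → Fin r → MvPolynomial (Fin n) A} {c : Fin s → Fin r}
  {α : Fin s → Fin n →₀ ℕ}

theorem exists_standard_representation (G : MonicGB m w K g c α)
    (κ : WithTop (m.syn ×ₗ (Fin r)ᵒᵈ)) : ∀ h ∈ K,
    (∀ j b, coeff b (h j) ≠ 0 → (key m w j b : WithTop (m.syn ×ₗ (Fin r)ᵒᵈ)) < κ) →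
    ∃ p : Fin s → MvPolynomial (Fin n) A, ∑ k, p k • g k = h ∧
      ∀ k b, coeff b (p k) ≠ 0 →
        (key m w (c k) (α k + b) : WithTop (m.syn ×ₗ (Fin r)ᵒᵈ)) < κ := by
  classical
  induction κ using WellFoundedLT.induction with
  | ind κ ih =>
  intro h hK hκ
  by_cases h0 : h = 0
  · exact ⟨0, by simp [h0], by simp⟩
  obtain ⟨i, a, hl⟩ := exists_isLead m w h0
  obtain ⟨k, rfl, hk⟩ := G.div h hK i a hl
  have hlt := hκ _ _ hl.1
  obtain ⟨d, rfl⟩ := exists_add_of_le hk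
  obtain ⟨p, hp, hpκ⟩ := ih _ hlt (h - monomial d (coeff (α k + d) (h (c k))) • g k)
    (K.sub_mem hK (K.smul_mem _ (G.mem k))) (by
      intro j b hb
      rw [WithTop.coe_lt_coe]
      refine lt_of_le_of_ne ?_ ?_
      · rw [Pi.sub_apply, coeff_sub] at hb
        by_cases hb' : coeff b (h j) = 0
        · exact G.coeff_monomial_smul_le k d _ (fun h' => hb (by rw [hb', h', sub_zero]))
        · exact hl.2 _ _ hb'
      · intro he
        obtain ⟨rfl, rfl⟩ := key_inj he
        rw [Pi.sub_apply, coeff_sub, G.coeff_monomial_smul_lead, sub_self] at hb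
        exact hb rfl)
  refine ⟨p + Pi.single k (monomial d (coeff (α k + d) (h (c k)))), ?_, ?_⟩
  · simp only [Pi.add_apply, add_smul, Finset.sum_add_distrib, hp]
    rw [Finset.sum_eq_single k (by intro j _ hj; simp [hj]) (by simp)]
    simp
  · intro l b hb
    by_cases hb' : coeff b (p l) = 0
    · rw [Pi.add_apply, coeff_add, hb', zero_add] at hb
      by_cases hlk : l = k
      · subst hlk
        rw [Pi.single_eq_same, coeff_monomial] at hb
        split_ifs at hb with hdb
        · subst hdb; exact hlt
        · exact absurd rfl hb
      · rw [Pi.single_eq_of_ne hlk] at hb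
        simp at hb
    · exact (hpκ _ _ hb').trans hlt

theorem range_linearCombination (G : MonicGB m w K g c α) :
    LinearMap.range (Fintype.linearCombination (MvPolynomial (Fin n) A) g) = K := by
  apply le_antisymm
  · rw [Fintype.range_linearCombination, Submodule.span_le]
    rintro _ ⟨k, rfl⟩
    exact G.mem k
  · intro h hK
    obtain ⟨p, hp, -⟩ := G.exists_standard_representation ⊤ h hK
      (fun _ _ _ => WithTop.coe_lt_top _)
    exact ⟨p, by rw [Fintype.linearCombination_apply, hp]⟩

/-- The leading monomial of a syzygy `q` is divisible by the leading monomial of some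
S-pair syzygy. -/
theorem exists_dvd_of_mem_ker (G : MonicGB m w K g c α) (hc : Monotone c)
    {q : Fin s → MvPolynomial (Fin n) A}
    (hq : q ∈ LinearMap.ker (Fintype.linearCombination (MvPolynomial (Fin n) A) g))
    {k : Fin s} {b : Fin n →₀ ℕ} (hl : IsLead m (fun k => α k + w (c k)) q k b) :
    ∃ l, k < l ∧ c k = c l ∧ α l ≤ α k + b := by
  classical
  by_contra! hno
  rw [LinearMap.mem_ker, Fintype.linearCombination_apply] at hq
  have hq' := congrArg (fun h => coeff (α k + b) (h (c k))) hq
  simp only [Finset.sum_apply, Pi.smul_apply, smul_eq_mul, coeff_sum, coeff_mul, Pi.zero_apply,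
    coeff_zero] at hq'
  have key_eq : ∀ j b' b'', b' + b'' = α k + b → coeff b' (q j) ≠ 0 →
      coeff b'' (g j (c k)) ≠ 0 → j = k ∧ b' = b := by
    intro j b' b'' hadd h1 h2
    have e1 := hl.2 j b' h1
    have e2 := key_add_le (G.le j _ _ h2) b'
    rw [add_comm b'', hadd] at e2
    rw [key_le_iff] at e1 e2
    have hle : m.toSyn (b' + (α j + w (c j))) ≤ m.toSyn (b + (α k + w (c k))) := by
      rcases e1 with e1 | e1
      · exact e1.le
      · rw [e1.1]
    have hE : α k + b + w (c k) = b + (α k + w (c k)) := by abel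
    have hE' : α j + b' + w (c j) = b' + (α j + w (c j)) := by abel
    rw [hE, hE'] at e2
    rcases e2 with e2 | ⟨e2, e2'⟩
    · exact absurd e2 hle.not_gt
    rcases e1 with e1 | ⟨-, hkj⟩
    · rw [e2] at e1; exact absurd e1 (lt_irrefl _)
    have hcc : c k = c j := le_antisymm (hc hkj) e2'
    rw [← hE, ← hE', hcc] at e2
    have e3 := add_right_cancel e2
    rcases hkj.eq_or_lt with rfl | hlt
    · exact ⟨rfl, (add_left_cancel e3).symm⟩
    · exact absurd (e3 ▸ le_self_add) (hno j hlt hcc)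
  rw [Finset.sum_eq_single k, Finset.sum_eq_single (b, α k)] at hq'
  · rw [G.coeff_eq, mul_one] at hq'
    exact hl.1 hq'
  · rintro ⟨b', b''⟩ hx hne
    rw [Finset.HasAntidiagonal.mem_antidiagonal] at hx
    by_contra h0
    obtain ⟨-, rfl⟩ := key_eq k b' b'' hx (left_ne_zero_of_mul h0) (right_ne_zero_of_mul h0)
    apply hne
    rw [add_comm] at hx
    exact Prod.ext rfl (add_right_cancel hx)
  · intro h0
    exact absurd (Finset.HasAntidiagonal.mem_antidiagonal.2 (add_comm _ _)) h0
  · intro j _ hj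
    refine Finset.sum_eq_zero fun x hx => ?_
    by_contra h0
    exact hj (key_eq j x.1 x.2 (Finset.HasAntidiagonal.mem_antidiagonal.1 hx) (left_ne_zero_of_mul h0)
      (right_ne_zero_of_mul h0)).1
  · simp

theorem exists_syzygy (G : MonicGB m w K g c α) (hc : Monotone c) {k l : Fin s} (hkl : k < l)
    (hckl : c k = c l) :
    ∃ q ∈ LinearMap.ker (Fintype.linearCombination (MvPolynomial (Fin n) A) g),
      coeff (α l - α k) (q k) = 1 ∧ ∀ j b, coeff b (q j) ≠ 0 →
        key m (fun k => α k + w (c k)) j b ≤ key m (fun k => α k + w (c k)) k (α l - α k) := by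
  classical
  have hlcm : α k + (α l - α k) = α l + (α k - α l) := by
    ext x; simp only [Finsupp.add_apply, Finsupp.tsub_apply]; omega
  obtain ⟨p, hp, hpκ⟩ := G.exists_standard_representation
    (key m w (c k) (α k + (α l - α k)) : WithTop (m.syn ×ₗ (Fin r)ᵒᵈ))
    (monomial (α l - α k) 1 • g k - monomial (α k - α l) 1 • g l)
    (K.sub_mem (K.smul_mem _ (G.mem k)) (K.smul_mem _ (G.mem l))) (by
      intro j b hb
      rw [WithTop.coe_lt_coe]
      rw [Pi.sub_apply, coeff_sub] at hb
      refine lt_of_le_of_ne ?_ ?_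
      · by_cases hb' : coeff b ((monomial (α l - α k) (1 : A) • g k) j) = 0
        · rw [hlcm, hckl]
          exact G.coeff_monomial_smul_le l _ _ (fun h' => hb (by rw [hb', h', sub_zero]))
        · exact G.coeff_monomial_smul_le k _ _ hb'
      · intro he
        obtain ⟨rfl, rfl⟩ := key_inj he
        rw [G.coeff_monomial_smul_lead, hlcm, hckl, G.coeff_monomial_smul_lead, sub_self] at hb
        exact hb rfl)
  have hplt : ∀ j b, coeff b (p j) ≠ 0 →
      key m (fun k => α k + w (c k)) j b < key m (fun k => α k + w (c k)) k (α l - α k) := by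
    intro j b hb
    have h1 := hpκ j b hb
    rw [WithTop.coe_lt_coe, key_lt_iff] at h1
    rw [key_lt_iff]
    have hE : α k + (α l - α k) + w (c k) = (α l - α k) + (α k + w (c k)) := by
      rw [add_comm (α k), add_assoc]
    have hE' : α j + b + w (c j) = b + (α j + w (c j)) := by abel
    rw [hE, hE'] at h1
    exact h1.imp_right fun h => ⟨h.1, hc.reflect_lt h.2⟩
  have hllt : key m (fun k => α k + w (c k)) l (α k - α l) <
      key m (fun k => α k + w (c k)) k (α l - α k) := by
    rw [key_lt_iff]
    refine Or.inr ⟨?_, hkl⟩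
    rw [hckl, ← add_assoc, ← add_assoc, add_comm _ (α l), add_comm _ (α k), hlcm]
  refine ⟨Pi.single k (monomial (α l - α k) 1) - Pi.single l (monomial (α k - α l) 1) - p,
    ?_, ?_, ?_⟩
  · rw [LinearMap.mem_ker, map_sub, map_sub, Fintype.linearCombination_apply_single,
      Fintype.linearCombination_apply_single, Fintype.linearCombination_apply, hp, sub_self]
  · have : coeff (α l - α k) (p k) = 0 := by
      by_contra h0
      exact lt_irrefl _ (hplt _ _ h0)
    simp [this, hkl.ne]
  · intro j b hb
    by_cases hb' : coeff b (p j) = 0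
    · rw [Pi.sub_apply, Pi.sub_apply, coeff_sub, coeff_sub, hb', sub_zero] at hb
      by_cases hjk : j = k
      · subst hjk
        rw [Pi.single_eq_same, Pi.single_eq_of_ne hkl.ne, coeff_zero, sub_zero,
          coeff_monomial] at hb
        split_ifs at hb with hd
        · rw [hd]
        · exact absurd rfl hb
      · rw [Pi.single_eq_of_ne hjk, coeff_zero, zero_sub] at hb
        by_cases hjl : j = l
        · subst hjl
          rw [Pi.single_eq_same, coeff_monomial] at hb
          split_ifs at hb with hd
          · rw [← hd]; exact hllt.le
          · simp at hb
        · rw [Pi.single_eq_of_ne hjl] at hb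
          simp at hb
    · exact (hplt j b hb').le

/-- Schreyer's theorem: the S-pair syzygies form a Gröbner basis of the syzygy module. -/
theorem schreyer (G : MonicGB m w K g c α) (hc : Monotone c) :
    ∃ q : {p : Fin s × Fin s // p.1 < p.2 ∧ c p.1 = c p.2} → Fin s → MvPolynomial (Fin n) A,
      MonicGB m (fun k => α k + w (c k))
        (LinearMap.ker (Fintype.linearCombination (MvPolynomial (Fin n) A) g)) q
        (fun p => p.1.1) (fun p => α p.1.2 - α p.1.1) := by
  choose q hq using fun p : {p : Fin s × Fin s // p.1 < p.2 ∧ c p.1 = c p.2} =>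
    G.exists_syzygy hc p.2.1 p.2.2
  refine ⟨q, fun p => (hq p).1, fun p => (hq p).2.1, fun p => (hq p).2.2, ?_⟩
  intro h hK i a hl
  obtain ⟨l, hl1, hl2, hl3⟩ := G.exists_dvd_of_mem_ker hc hK hl
  exact ⟨⟨(i, l), hl1, hl2⟩, rfl, tsub_le_iff_left.2 hl3⟩

/-- A finite Gröbner basis can be sorted by any key refining the index of the leading basis
vector. -/
theorem exists_sorted {ι β : Type*} [Finite ι] [LinearOrder β]
    {g : ι → Fin r → MvPolynomial (Fin n) A} {c : ι → Fin r} {α : ι → Fin n →₀ ℕ}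
    (G : MonicGB m w K g c α) (φ : ι → β) :
    ∃ (s : ℕ) (e : Fin s ≃ ι), MonicGB m w K (g ∘ e) (c ∘ e) (α ∘ e) ∧
      Monotone fun k => toLex (c (e k), φ (e k)) := by
  obtain ⟨s, ⟨e⟩⟩ := Finite.exists_equiv_fin ι
  let f : Fin s → Fin r ×ₗ β := fun k => toLex (c (e.symm k), φ (e.symm k))
  exact ⟨s, (Tuple.sort f).trans e.symm, G.comp_equiv _, Tuple.monotone_sort f⟩

end MonicGB

end

end ModuleGroebner

namespace PaperGB.HasFiniteFreeResolutionOfLength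

theorem of_bijective {S M : Type*} [CommRing S] [AddCommGroup M] [Module S M] {s : ℕ}
    (φ : (Fin s → S) →ₗ[S] M) (hφ : Function.Bijective φ) :
    HasFiniteFreeResolutionOfLength S M 0 := by
  refine ⟨fun i => if i = 0 then s else 0, fun _ => 0, φ, fun i hi => if_neg hi.ne', hφ.2, ?_, ?_⟩
  · rw [LinearMap.range_zero]
    exact (LinearMap.ker_eq_bot.2 hφ.1).symm
  · intro i
    have : Subsingleton (Fin (if i + 1 = 0 then s else 0) → S) := by
      rw [if_neg i.succ_ne_zero]; infer_instance
    exact Subsingleton.elim _ _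

theorem succ_of_surjective {S M : Type*} [CommRing S] [AddCommGroup M] [Module S M] {s p : ℕ}
    (φ : (Fin s → S) →ₗ[S] M) (hφ : Function.Surjective φ)
    (h : HasFiniteFreeResolutionOfLength S (LinearMap.ker φ) p) :
    HasFiniteFreeResolutionOfLength S M (p + 1) := by
  obtain ⟨d, g, ε, hd, hε, h0, hg⟩ := h
  refine ⟨fun i => i.casesOn s d,
    fun i => match i with
      | 0 => (LinearMap.ker φ).subtype ∘ₗ ε
      | i + 1 => g i, φ, ?_, hφ, ?_, ?_⟩
  · rintro (_ | i) hi
    · omega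
    · exact hd i (by omega)
  · change LinearMap.range ((LinearMap.ker φ).subtype ∘ₗ ε) = LinearMap.ker φ
    rw [LinearMap.range_comp, LinearMap.range_eq_top.2 hε, Submodule.map_top,
      Submodule.range_subtype]
  · rintro (_ | i)
    · change LinearMap.range (g 0) = LinearMap.ker ((LinearMap.ker φ).subtype ∘ₗ ε)
      rw [h0, LinearMap.ker_comp_of_ker_eq_bot _ (Submodule.ker_subtype _)]
    · exact hg i

end PaperGB.HasFiniteFreeResolutionOfLength

namespace ModuleGroebner

namespace MonicGB

variable {n : ℕ} {A : Type*} [CommRing A] {m : MonomialOrder (Fin n)}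

theorem exists_injective {r : ℕ} {w : Fin r → Fin n →₀ ℕ}
    {K : Submodule (MvPolynomial (Fin n) A) (Fin r → MvPolynomial (Fin n) A)} {ι : Type*}
    {g : ι → Fin r → MvPolynomial (Fin n) A} {c : ι → Fin r} {α : ι → Fin n →₀ ℕ}
    (G : MonicGB m w K g c α) (hα : ∀ k, α k = 0) :
    ∃ g' : Set.range c → Fin r → MvPolynomial (Fin n) A,
      MonicGB m w K g' Subtype.val (fun _ => 0) := by
  choose f hf using fun x : Set.range c => x.2
  refine ⟨g ∘ f, fun k => G.mem _, fun k => ?_, fun k j b hb => ?_, fun h hh i a hl => ?_⟩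
  · simpa [hα, hf] using G.coeff_eq (f k)
  · simpa [hα, hf] using G.le (f k) j b hb
  · obtain ⟨k, hk, -⟩ := G.div h hh i a hl
    exact ⟨⟨i, k, hk⟩, rfl, zero_le⟩

/-- A submodule with a finite monic Gröbner basis whose leading monomials only involve the last `t`
variables has a finite free resolution of length `t`. -/
theorem hasFiniteFreeResolution (t : ℕ) : ∀ {r : ℕ} {w : Fin r → Fin n →₀ ℕ}
    {K : Submodule (MvPolynomial (Fin n) A) (Fin r → MvPolynomial (Fin n) A)} {ι : Type}
    [Finite ι] {g : ι → Fin r → MvPolynomial (Fin n) A} {c : ι → Fin r} {α : ι → Fin n →₀ ℕ},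
    MonicGB m w K g c α → (∀ k (x : Fin n), x.val + t < n → α k x = 0) →
    HasFiniteFreeResolutionOfLength (MvPolynomial (Fin n) A) K t := by
  induction t with
  | zero =>
    intro r w K ι _ g c α G hα
    obtain ⟨g', G'⟩ := G.exists_injective fun k => Finsupp.ext fun x => hα k x x.2
    obtain ⟨s, e, G'', hs⟩ := G'.exists_sorted fun _ => ()
    have hc : Monotone (Subtype.val ∘ e : Fin s → Fin r) := Prod.Lex.monotone_fst_ofLex.comp hs
    refine .of_bijective ((Fintype.linearCombination (MvPolynomial (Fin n) A) (g' ∘ e)).codRestrict K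
      fun q => G''.range_linearCombination.le ⟨q, rfl⟩) ⟨?_, ?_⟩
    · rw [← LinearMap.ker_eq_bot, LinearMap.ker_codRestrict, Submodule.eq_bot_iff]
      intro q hq
      by_contra h0
      obtain ⟨i, a, hl⟩ := exists_isLead m
        (fun k => ((fun _ => 0) ∘ e : Fin s → Fin n →₀ ℕ) k + w ((Subtype.val ∘ e) k)) h0
      obtain ⟨l, hil, hcl, -⟩ := G''.exists_dvd_of_mem_ker hc hq hl
      exact hil.ne (e.injective (Subtype.val_injective hcl))
    · rw [← LinearMap.range_eq_top, LinearMap.range_codRestrict, G''.range_linearCombination,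
        Submodule.comap_subtype_self]
  | succ t ih =>
    intro r w K ι _ g c α G hα
    obtain ⟨s, e, G', hs⟩ := G.exists_sorted fun k =>
      OrderDual.toDual (if h : t < n then α k ⟨n - 1 - t, by omega⟩ else 0)
    have hc : Monotone (c ∘ e) := Prod.Lex.monotone_fst_ofLex.comp hs
    obtain ⟨q, Q⟩ := G'.schreyer hc
    refine .succ_of_surjective
      ((Fintype.linearCombination (MvPolynomial (Fin n) A) (g ∘ e)).codRestrict K
        fun q => G'.range_linearCombination.le ⟨q, rfl⟩) ?_ ?_
    · rw [← LinearMap.range_eq_top, LinearMap.range_codRestrict, G'.range_linearCombination,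
        Submodule.comap_subtype_self]
    · rw [LinearMap.ker_codRestrict]
      refine ih Q ?_
      rintro ⟨⟨k, l⟩, hkl, hckl⟩ x hx
      rw [Finsupp.tsub_apply, tsub_eq_zero_iff_le]
      by_cases hx' : x.val + (t + 1) < n
      · exact (hα _ x hx').trans_le zero_le
      · have hxt : x = ⟨n - 1 - t, by omega⟩ := Fin.ext (by simp; omega)
        have h := hs hkl.le
        rw [Prod.Lex.le_iff] at h
        rcases h with h | ⟨-, h⟩
        · exact absurd hckl h.ne
        · rw [hxt]
          simpa [show t < n by omega] using h

end MonicGB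

end ModuleGroebner

namespace PaperGB

variable {n : ℕ} {A : Type*} [CommRing A]

theorem coeff_mDeg_ne_zero (m : MonomialOrder (Fin n)) {f : MvPolynomial (Fin n) A} (hf : f ≠ 0) :
    coeff (mDeg m f) f ≠ 0 := by
  obtain ⟨d, hd, h⟩ := Finset.exists_mem_eq_sup f.support (support_nonempty.2 hf)
    fun d => m.toSyn d
  rw [mDeg, h]
  simpa using hd

theorem le_mDeg (m : MonomialOrder (Fin n)) {f : MvPolynomial (Fin n) A} {b : Fin n →₀ ℕ}
    (hb : coeff b f ≠ 0) : m.toSyn b ≤ m.toSyn (mDeg m f) := by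
  rw [mDeg, AddEquiv.apply_symm_apply]
  exact Finset.le_sup (f := fun d => m.toSyn d) (mem_support_iff.2 hb)

open ModuleGroebner in
theorem IsGroebnerBasis.monicGB {m : MonomialOrder (Fin n)} {I : Ideal (MvPolynomial (Fin n) A)}
    {s : ℕ} {f : Fin s → MvPolynomial (Fin n) A} (hG : IsGroebnerBasis m I f)
    (hu : ∀ i, IsUnit (mLC m (f i))) :
    MonicGB m (fun _ : Fin 1 => 0) (Submodule.comap (LinearMap.proj 0) I)
      (fun i _ => C (Ring.inverse (mLC m (f i))) * f i) (fun _ => 0) (fun i => mDeg m (f i)) where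
  mem i := I.mul_mem_left _ (hG.2.1 i)
  coeff_eq i := by
    rw [coeff_C_mul]
    exact Ring.inverse_mul_cancel _ (hu i)
  le i j b hb := by
    rw [coeff_C_mul] at hb
    rw [key_le_iff]
    rcases (le_mDeg m (right_ne_zero_of_mul hb)).lt_or_eq with h | h
    · exact Or.inl (by simpa using h)
    · exact Or.inr ⟨by simpa using h, Fin.zero_le _⟩
  div h hh i a hl := by
    obtain rfl := Subsingleton.elim i 0
    have h0 : h 0 ≠ 0 := fun h0 => hl.1 (by rw [h0, coeff_zero])
    have ha : a = mDeg m (h 0) := by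
      apply m.toSyn.injective
      refine (le_mDeg m hl.1).antisymm ?_
      have h1 := hl.2 0 _ (coeff_mDeg_ne_zero m h0)
      rw [key_le_iff] at h1
      rcases h1 with h1 | h1
      · exact (by simpa using h1 : m.toSyn (mDeg m (h 0)) < m.toSyn a).le
      · exact (congrArg m.toSyn (by simpa using h1)).le
    have hmem : mLT m (h 0) ∈ Ideal.span ((fun d => monomial d (1 : A)) ''
        Set.range fun i => mDeg m (f i)) := by
      have h1 : mLT m (h 0) ∈ mLTIdeal m I := Ideal.subset_span ⟨h 0, ⟨hh, h0⟩, rfl⟩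
      rw [← hG.2.2] at h1
      refine Ideal.span_le.2 ?_ h1
      rintro _ ⟨i, rfl⟩
      have h2 : mLT m (f i) = C (mLC m (f i)) * monomial (mDeg m (f i)) 1 := by
        rw [C_mul_monomial, mul_one, mLT]
      rw [SetLike.mem_coe]
      dsimp only
      rw [h2]
      exact Ideal.mul_mem_left _ _ (Ideal.subset_span ⟨_, ⟨i, rfl⟩, rfl⟩)
    rw [mem_ideal_span_monomial_image] at hmem
    obtain ⟨_, ⟨k, rfl⟩, hk⟩ := hmem (mDeg m (h 0)) (by
      rw [mem_support_iff, mLT, coeff_monomial, if_pos rfl]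
      exact coeff_mDeg_ne_zero m h0)
    exact ⟨k, rfl, hk.trans_eq ha.symm⟩

/-- If the leading coefficients of a Gröbner basis are units, the quotient has a finite free
resolution of length `n + 1`. -/
theorem IsGroebnerBasis.hasFiniteFreeResolution {m : MonomialOrder (Fin n)}
    {I : Ideal (MvPolynomial (Fin n) A)} {s : ℕ} {f : Fin s → MvPolynomial (Fin n) A}
    (hG : IsGroebnerBasis m I f) (hu : ∀ i, IsUnit (mLC m (f i))) :
    HasFiniteFreeResolutionOfLength (MvPolynomial (Fin n) A) (MvPolynomial (Fin n) A ⧸ I)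
      (n + 1) := by
  refine .succ_of_surjective (s := 1) (I.mkQ ∘ₗ LinearMap.proj 0) ?_ ?_
  · exact I.mkQ_surjective.comp (LinearMap.proj_surjective 0)
  · rw [LinearMap.ker_comp, Submodule.ker_mkQ]
    exact (hG.monicGB hu).hasFiniteFreeResolution n fun _ x hx => by omega

end PaperGB

theorem Ideal.Quotient.isUnit_of_mem_nonZeroDivisors_of_span_singleton {R : Type*} [CommRing R]
    [IsDomain R] [IsPrincipalIdealRing R] {N : R} (hN : N ≠ 0) {x : R ⧸ Ideal.span {N}}
    (hx : x ∈ nonZeroDivisors (R ⧸ Ideal.span {N})) : IsUnit x := by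
  obtain ⟨c, rfl⟩ := Ideal.Quotient.mk_surjective x
  obtain ⟨d, hd⟩ := (IsPrincipalIdealRing.principal (Ideal.span {c, N})).principal
  rw [Ideal.submodule_span_eq] at hd
  obtain ⟨c', rfl⟩ : d ∣ c := Ideal.mem_span_singleton.1 (hd ▸ Ideal.subset_span (by simp))
  obtain ⟨N', rfl⟩ : d ∣ N := Ideal.mem_span_singleton.1 (hd ▸ Ideal.subset_span (by simp))
  have h1 : Ideal.Quotient.mk (Ideal.span {d * N'}) N' = 0 := by
    refine (mul_right_mem_nonZeroDivisors_eq_zero_iff hx).1 ?_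
    rw [← map_mul, Ideal.Quotient.eq_zero_iff_mem, Ideal.mem_span_singleton]
    exact ⟨c', by ring⟩
  rw [Ideal.Quotient.eq_zero_iff_mem, Ideal.mem_span_singleton] at h1
  obtain ⟨e, he⟩ := h1
  have hde : 1 = d * e := mul_left_cancel₀ (right_ne_zero_of_mul hN) (by linear_combination he)
  have hd1 : (1 : R) ∈ Ideal.span {d * c', d * N'} := by
    rw [hd]
    exact Ideal.mem_span_singleton.2 ⟨e, hde⟩
  obtain ⟨a, b, hab⟩ := Ideal.mem_span_pair.1 hd1
  refine IsUnit.of_mul_eq_one (Ideal.Quotient.mk _ a) ?_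
  rw [← map_mul, ← map_one (Ideal.Quotient.mk _), Ideal.Quotient.mk_eq_mk_iff_sub_mem,
    Ideal.mem_span_singleton]
  exact ⟨-b, by linear_combination hab⟩

/-- over `R̄ = R/NR`, if an ideal `I` admits a Gröbner basis all of whose
leading coefficients are nonzerodivisors, then `S/I` has a finite free resolution of
length at most `n+1`. -/
theorem finite_free_resolution_of_regular_groebnerBasis_quotient_PID
    {n : ℕ} {R : Type*} [CommRing R] [IsDomain R] [IsPrincipalIdealRing R]
    (N : R) (hN0 : N ≠ 0) (hNu : ¬ IsUnit N)
    (m : MonomialOrder (Fin n))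
    (I : Ideal (MvPolynomial (Fin n) (R ⧸ Ideal.span {N})))
    {M : ℕ} (f : Fin M → MvPolynomial (Fin n) (R ⧸ Ideal.span {N}))
    (hG : IsGroebnerBasis m I f)
    (hreg : ∀ i, mLC m (f i) ∈ nonZeroDivisors (R ⧸ Ideal.span {N})) :
    ∃ p ≤ n + 1, HasFiniteFreeResolutionOfLength
      (MvPolynomial (Fin n) (R ⧸ Ideal.span {N}))
      (MvPolynomial (Fin n) (R ⧸ Ideal.span {N}) ⧸ I) p := by
  exact ⟨n + 1, le_rfl, hG.hasFiniteFreeResolution fun i =>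
    Ideal.Quotient.isUnit_of_mem_nonZeroDivisors_of_span_singleton hN0 (hreg i)⟩
end

section
/- (Hilbert's syzygy theorem for a finite direct product.) Let R = ∏_{i=1}^{t} R_i/N_iR_i, where each R_i is a principal ideal domain and each N_i ∈ R_i is not a unit (N_i may be zero). Let S = R[x_1,…,x_n] and let M be a finitely generated S-module. Then there exist p ≤ n+1 and finitely generated free S-modules F_0,…,F_p together with an exact sequence ⋯ → F_p → F_p → F_p → F_{p−1} → ⋯ → F_1 → F_0 → M → 0; that is, an infinite free resolution (G_i)_{i≥0} of M by finitely generated free S-modules with G_i = F_i for 0 ≤ i ≤ p and G_i = F_p for all i ≥ p. -/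
open MvPolynomial
open scoped MonomialOrder

open PaperGB

namespace PaperGB

section Resolution

variable {S : Type*} [CommRing S]

/-- `M` has an infinite free resolution whose `i`-th term is free of rank `d i`. -/
def HasFreeResolution (S : Type*) [CommRing S] (M : Type*) [AddCommGroup M] [Module S M]
    (d : ℕ → ℕ) : Prop :=
  ∃ (g : ∀ i : ℕ, (Fin (d (i + 1)) → S) →ₗ[S] (Fin (d i) → S)) (ε : (Fin (d 0) → S) →ₗ[S] M),
    Function.Surjective ε ∧
    LinearMap.range (g 0) = LinearMap.ker ε ∧
    ∀ i, LinearMap.range (g (i + 1)) = LinearMap.ker (g i)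

theorem HasFreeResolution.of_equiv {M N : Type*} [AddCommGroup M] [Module S M]
    [AddCommGroup N] [Module S N] (e : M ≃ₗ[S] N) {d : ℕ → ℕ} (h : HasFreeResolution S M d) :
    HasFreeResolution S N d := by
  obtain ⟨g, ε, hs, h0, hg⟩ := h
  refine ⟨g, e.toLinearMap ∘ₗ ε, e.surjective.comp hs, ?_, hg⟩
  rw [h0, LinearEquiv.ker_comp]

theorem HasFreeResolution.exists_ker {M : Type*} [AddCommGroup M] [Module S M] {d : ℕ → ℕ}
    (h : HasFreeResolution S M d) :
    ∃ f : (Fin (d 0) → S) →ₗ[S] M, Function.Surjective f ∧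
      HasFreeResolution S (LinearMap.ker f) (fun i => d (i + 1)) := by
  obtain ⟨g, ε, hs, h0, hg⟩ := h
  refine ⟨ε, hs, fun i => g (i + 1),
    (g 0).codRestrict (LinearMap.ker ε) (fun x => h0 ▸ LinearMap.mem_range_self _ x), ?_, ?_,
    fun i => hg (i + 1)⟩
  · rw [← LinearMap.range_eq_top, LinearMap.range_codRestrict, h0, Submodule.comap_subtype_self]
  · rw [LinearMap.ker_codRestrict, ← hg 0]

theorem HasFreeResolution.of_ker {M : Type*} [AddCommGroup M] [Module S M] {m : ℕ} {d : ℕ → ℕ}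
    (f : (Fin m → S) →ₗ[S] M) (hf : Function.Surjective f)
    (h : HasFreeResolution S (LinearMap.ker f) d) :
    HasFreeResolution S M (fun i => Nat.casesOn i m d) := by
  obtain ⟨g, ε, hs, h0, hg⟩ := h
  refine ⟨fun i => match i with
    | 0 => (LinearMap.ker f).subtype ∘ₗ ε
    | i + 1 => g i, f, hf, ?_, ?_⟩
  · change LinearMap.range ((LinearMap.ker f).subtype ∘ₗ ε) = _
    rw [LinearMap.range_comp, LinearMap.range_eq_top.2 hs, Submodule.map_top,
      Submodule.range_subtype]
  · rintro (_ | i)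
    · change LinearMap.range (g 0) = LinearMap.ker ((LinearMap.ker f).subtype ∘ₗ ε)
      rw [h0, LinearMap.ker_comp, Submodule.ker_subtype, ← LinearMap.ker]
    · exact hg i

/-- Coinduction: an invariant of the successive kernels which allows one to choose the next
surjection produces a free resolution. -/
theorem HasFreeResolution.coinduction {M : Type*} [AddCommGroup M] [Module S M] (d : ℕ → ℕ)
    (P : ∀ i, Submodule S (Fin (d i) → S) → Prop)
    (step : ∀ i K, P i K → ∃ f : (Fin (d (i + 1)) → S) →ₗ[S] K, Function.Surjective f ∧
      P (i + 1) (LinearMap.ker f))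
    (f : (Fin (d 0) → S) →ₗ[S] M) (hf : Function.Surjective f) (h0 : P 0 (LinearMap.ker f)) :
    HasFreeResolution S M d := by
  choose F hF hP using step
  let K : ∀ i, {K : Submodule S (Fin (d i) → S) // P i K} := fun i =>
    Nat.rec ⟨LinearMap.ker f, h0⟩ (fun i K => ⟨LinearMap.ker (F i K.1 K.2), hP i K.1 K.2⟩) i
  have hr : ∀ i, LinearMap.range ((K i).1.subtype ∘ₗ F i (K i).1 (K i).2) = (K i).1 := fun i => by
    rw [LinearMap.range_comp, LinearMap.range_eq_top.2 (hF _ _ _), Submodule.map_top,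
      Submodule.range_subtype]
  refine ⟨fun i => (K i).1.subtype ∘ₗ F i (K i).1 (K i).2, f, hf, hr 0, fun i => ?_⟩
  rw [hr (i + 1), LinearMap.ker_comp, Submodule.ker_subtype]
  rfl

theorem exists_ker_exact {A M C : Type*} [AddCommGroup A] [Module S A] [AddCommGroup M]
    [Module S M] [AddCommGroup C] [Module S C] (i : A →ₗ[S] M) (p : M →ₗ[S] C)
    (hi : Function.Injective i) (hp : Function.Surjective p) (hip : Function.Exact i p)
    {a c : ℕ} (fA : (Fin a → S) →ₗ[S] A) (fC : (Fin c → S) →ₗ[S] C)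
    (hA : Function.Surjective fA) (hC : Function.Surjective fC) :
    ∃ f : (Fin (a + c) → S) →ₗ[S] M, Function.Surjective f ∧
      ∃ (j : LinearMap.ker fA →ₗ[S] LinearMap.ker f) (q : LinearMap.ker f →ₗ[S] LinearMap.ker fC),
        Function.Injective j ∧ Function.Surjective q ∧ Function.Exact j q := by
  obtain ⟨s, hs⟩ := Module.projective_lifting_property p fC hp
  have hs' : ∀ y, p (s y) = fC y := fun y => LinearMap.congr_fun hs y
  have hpi : ∀ x, p (i x) = 0 := fun x => (hip _).2 ⟨x, rfl⟩
  let e : (Fin (a + c) → S) ≃ₗ[S] (Fin a → S) × (Fin c → S) :=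
    (LinearEquiv.funCongrLeft S S finSumFinEquiv).trans
      (LinearEquiv.sumArrowLequivProdArrow (Fin a) (Fin c) S S)
  let f : (Fin (a + c) → S) →ₗ[S] M := ((i ∘ₗ fA).coprod s) ∘ₗ e.toLinearMap
  have hfe : ∀ z, f z = i (fA (e z).1) + s (e z).2 := fun z => by simp [f]
  have hfs : ∀ x y, f (e.symm (x, y)) = i (fA x) + s y := fun x y => by simp [hfe]
  refine ⟨f, fun m => ?_, ?_, ?_, ?_, ?_, ?_⟩
  · obtain ⟨y, hy⟩ := hC (p m)
    obtain ⟨a', ha'⟩ := (hip (m - s y)).1 (by rw [map_sub, hs', hy, sub_self])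
    obtain ⟨x, rfl⟩ := hA a'
    exact ⟨e.symm (x, y), by rw [hfs, ha', sub_add_cancel]⟩
  · exact (e.symm.toLinearMap ∘ₗ LinearMap.inl S _ _ ∘ₗ (LinearMap.ker fA).subtype).codRestrict _
      fun x => by
        change f (e.symm (x.1, 0)) = 0
        rw [hfs, LinearMap.mem_ker.1 x.2, map_zero, map_zero, add_zero]
  · exact (LinearMap.snd S _ _ ∘ₗ e.toLinearMap ∘ₗ (LinearMap.ker f).subtype).codRestrict _
      fun z => by
        have h := LinearMap.mem_ker.1 z.2
        rw [hfe] at h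
        have := congrArg p h
        rwa [map_add, hpi, zero_add, hs', map_zero] at this
  · intro x y h
    have h1 : e.symm (x.1, 0) = e.symm (y.1, 0) := congrArg Subtype.val h
    exact Subtype.ext (congrArg Prod.fst (e.symm.injective h1))
  · intro y
    have hy : p (s y.1) = 0 := by rw [hs', LinearMap.mem_ker.1 y.2]
    obtain ⟨a', ha'⟩ := (hip _).1 hy
    obtain ⟨x, rfl⟩ := hA a'
    refine ⟨⟨e.symm (-x, y.1), ?_⟩, Subtype.ext ?_⟩
    · rw [LinearMap.mem_ker, hfs, map_neg, map_neg, ha', neg_add_cancel]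
    · change (e (e.symm (-x, y.1))).2 = y.1
      rw [LinearEquiv.apply_symm_apply]
  · intro z
    constructor
    · intro h
      have h2 : (e z.1).2 = 0 := congrArg Subtype.val h
      have hz := LinearMap.mem_ker.1 z.2
      rw [hfe, h2, map_zero, add_zero] at hz
      refine ⟨⟨(e z.1).1, hi (by rw [hz, map_zero])⟩, Subtype.ext ?_⟩
      change e.symm ((e z.1).1, 0) = z.1
      rw [← h2, Prod.mk.eta, LinearEquiv.symm_apply_apply]
    · rintro ⟨x, rfl⟩
      refine Subtype.ext ?_
      change (e (e.symm (x.1, 0))).2 = 0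
      rw [LinearEquiv.apply_symm_apply]

/-- The horseshoe lemma. -/
theorem HasFreeResolution.of_exact {A M C : Type*} [AddCommGroup A] [Module S A] [AddCommGroup M]
    [Module S M] [AddCommGroup C] [Module S C] (i : A →ₗ[S] M) (p : M →ₗ[S] C)
    (hi : Function.Injective i) (hp : Function.Surjective p) (hip : Function.Exact i p)
    {a c : ℕ → ℕ} (hA : HasFreeResolution S A a) (hC : HasFreeResolution S C c) :
    HasFreeResolution S M (fun i => a i + c i) := by
  obtain ⟨fA, hfA, hA⟩ := hA.exists_ker
  obtain ⟨fC, hfC, hC⟩ := hC.exists_ker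
  obtain ⟨f, hf, j, q, hj, hq, hjq⟩ := exists_ker_exact i p hi hp hip fA fC hfA hfC
  refine coinduction (fun i => a i + c i)
    (fun n K => ∃ (A : Submodule S (Fin (a n) → S)) (C : Submodule S (Fin (c n) → S))
      (j : A →ₗ[S] K) (q : K →ₗ[S] C), Function.Injective j ∧ Function.Surjective q ∧
        Function.Exact j q ∧ HasFreeResolution S A (fun k => a (n + 1 + k)) ∧
        HasFreeResolution S C (fun k => c (n + 1 + k))) ?_ f hf
    ⟨_, _, j, q, hj, hq, hjq, by simpa only [zero_add, add_comm 1] using hA,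
      by simpa only [zero_add, add_comm 1] using hC⟩
  rintro n K ⟨A, C, j, q, hj, hq, hjq, hA, hC⟩
  obtain ⟨fA, hfA, hA⟩ := hA.exists_ker
  obtain ⟨fC, hfC, hC⟩ := hC.exists_ker
  obtain ⟨f, hf, j, q, hj, hq, hjq⟩ := exists_ker_exact j q hj hq hjq fA fC hfA hfC
  exact ⟨f, hf, _, _, j, q, hj, hq, hjq,
    by simpa only [add_assoc, add_comm, add_left_comm] using hA,
    by simpa only [add_assoc, add_comm, add_left_comm] using hC⟩

/-- The resolution of a cokernel obtained from resolutions of the source and the target. -/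
theorem HasFreeResolution.cokernel {A M C : Type*} [AddCommGroup A] [Module S A] [AddCommGroup M]
    [Module S M] [AddCommGroup C] [Module S C] (i : A →ₗ[S] M) (p : M →ₗ[S] C)
    (hi : Function.Injective i) (hp : Function.Surjective p) (hip : Function.Exact i p)
    {a b : ℕ → ℕ} (hA : HasFreeResolution S A a) (hM : HasFreeResolution S M b) :
    HasFreeResolution S C (fun k => Nat.casesOn k (b 0) (fun k => b (k + 1) + a k)) := by
  obtain ⟨f, hf, hK⟩ := hM.exists_ker
  refine of_ker (p ∘ₗ f) (hp.comp hf) ?_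
  have hle : LinearMap.ker f ≤ LinearMap.ker (p ∘ₗ f) := LinearMap.ker_le_ker_comp f p
  let e := LinearEquiv.ofInjective i hi
  have hr : ∀ x : LinearMap.ker (p ∘ₗ f), f x.1 ∈ LinearMap.range i := fun x =>
    (hip _).1 (LinearMap.mem_ker.1 x.2)
  let q : LinearMap.ker (p ∘ₗ f) →ₗ[S] LinearMap.range i :=
    (f ∘ₗ (LinearMap.ker (p ∘ₗ f)).subtype).codRestrict _ hr
  refine of_exact (Submodule.inclusion hle) q (Submodule.inclusion_injective hle) ?_ ?_ hK
    (hA.of_equiv e)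
  · rintro ⟨_, y, rfl⟩
    obtain ⟨x, hx⟩ := hf (i y)
    exact ⟨⟨x, by simp [hx, (hip _).2 ⟨y, rfl⟩]⟩, Subtype.ext hx⟩
  · intro x
    constructor
    · intro h
      exact ⟨⟨x.1, congrArg Subtype.val h⟩, rfl⟩
    · rintro ⟨y, rfl⟩
      exact Subtype.ext y.2

end Resolution

section Polynomial

open Polynomial TensorProduct

variable {A : Type*} [CommRing A]

theorem HasFreeResolution.baseChange {B : Type*} [AddCommGroup B] [Module A B] (T : Type*)
    [CommRing T] [Algebra A T] [Module.Flat A T] {d : ℕ → ℕ} (h : HasFreeResolution A B d) :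
    HasFreeResolution T (T ⊗[A] B) d := by
  obtain ⟨g, ε, hs, h0, hg⟩ := h
  let e : ∀ i, T ⊗[A] (Fin (d i) → A) ≃ₗ[T] (Fin (d i) → T) := fun i =>
    TensorProduct.piScalarRight A T T (Fin (d i))
  have key0 : Function.Exact ((g 0).baseChange T) (ε.baseChange T) :=
    Module.Flat.lTensor_exact T (LinearMap.exact_iff.2 h0.symm)
  have key : ∀ i, Function.Exact ((g (i + 1)).baseChange T) ((g i).baseChange T) := fun i =>
    Module.Flat.lTensor_exact T (LinearMap.exact_iff.2 (hg i).symm)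
  refine ⟨fun i => (e i).toLinearMap ∘ₗ (g i).baseChange T ∘ₗ (e (i + 1)).symm.toLinearMap,
    ε.baseChange T ∘ₗ (e 0).symm.toLinearMap,
    (LinearMap.lTensor_surjective T hs).comp (e 0).symm.surjective, ?_, fun i => ?_⟩
  · rw [LinearMap.range_comp, LinearMap.range_comp, LinearEquiv.range, Submodule.map_top,
      ← LinearMap.exact_iff.1 key0,
      LinearMap.ker_comp, Submodule.map_equiv_eq_comap_symm]
  · rw [LinearMap.range_comp, LinearMap.range_comp, LinearEquiv.range, Submodule.map_top,
      ← LinearMap.exact_iff.1 (key i), LinearEquiv.ker_comp, LinearMap.ker_comp,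
      Submodule.map_equiv_eq_comap_symm]

theorem HasFreeResolution.of_ringEquiv {B : Type*} [CommRing B] (σ : A ≃+* B) {M N : Type*}
    [AddCommGroup M] [Module A M] [AddCommGroup N] [Module B N] (φ : M ≃+ N)
    (hφ : ∀ a m, φ (a • m) = σ a • φ m) {d : ℕ → ℕ} (h : HasFreeResolution A M d) :
    HasFreeResolution B N d := by
  obtain ⟨g, ε, hs, h0, hg⟩ := h
  let e : ∀ i, (Fin (d i) → A) ≃+ (Fin (d i) → B) := fun i =>
    AddEquiv.piCongrRight fun _ => σ.toAddEquiv
  have he : ∀ i b x, (e i).symm (b • x) = σ.symm b • (e i).symm x := fun i b x => by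
    ext j; simp [e]
  have he' : ∀ i b x, (e i) (b • x) = σ b • (e i) x := fun i b x => by
    ext j; simp [e]
  refine ⟨fun i =>
    { toFun := fun x => e i (g i ((e (i + 1)).symm x))
      map_add' := fun x y => by simp only [map_add]
      map_smul' := fun b x => by
        simp only [he, map_smul, he', RingEquiv.apply_symm_apply, RingHom.id_apply] },
    { toFun := fun x => φ (ε ((e 0).symm x))
      map_add' := fun x y => by simp only [map_add]
      map_smul' := fun b x => by
        simp only [he, map_smul, hφ, RingEquiv.apply_symm_apply, RingHom.id_apply] },
    φ.surjective.comp (hs.comp (e 0).symm.surjective), ?_, fun i => ?_⟩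
  · ext x
    have := SetLike.ext_iff.1 h0 ((e 0).symm x)
    simp only [LinearMap.mem_range, LinearMap.mem_ker, LinearMap.coe_mk, AddHom.coe_mk,
      EmbeddingLike.map_eq_zero_iff] at this ⊢
    rw [← this, (e 1).symm.surjective.exists (p := fun y => g 0 y = (e 0).symm x)]
    simp only [AddEquiv.eq_symm_apply]
  · ext x
    have := SetLike.ext_iff.1 (hg i) ((e (i + 1)).symm x)
    simp only [LinearMap.mem_range, LinearMap.mem_ker, LinearMap.coe_mk, AddHom.coe_mk,
      EmbeddingLike.map_eq_zero_iff] at this ⊢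
    rw [← this, (e (i + 1 + 1)).symm.surjective.exists
      (p := fun y => g (i + 1) y = (e (i + 1)).symm x)]
    simp only [AddEquiv.eq_symm_apply]

variable {B : Type*} [AddCommGroup B] [Module A B]

/-- The `j`-th coefficient of an element of `B[X] = A[X] ⊗ B`. -/
noncomputable def tensorCoeff (A B : Type*) [CommRing A] [AddCommGroup B] [Module A B] (j : ℕ) :
    A[X] ⊗[A] B →ₗ[A] B :=
  (TensorProduct.lid A B).toLinearMap ∘ₗ (Polynomial.lcoeff A j).rTensor B

@[simp]
theorem tensorCoeff_tmul (j : ℕ) (a : A[X]) (b : B) :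
    tensorCoeff A B j (a ⊗ₜ b) = a.coeff j • b := by
  simp [tensorCoeff]

theorem exists_eq_sum_tensorCoeff (t : A[X] ⊗[A] B) :
    ∃ k, ∀ l, k ≤ l →
      t = ∑ i ∈ Finset.range l, (Polynomial.X ^ i : A[X]) ⊗ₜ[A] tensorCoeff A B i t := by
  induction t with
  | zero => exact ⟨0, fun l _ => by simp⟩
  | tmul a b =>
    refine ⟨a.natDegree + 1, fun l hl => ?_⟩
    conv_lhs => rw [a.as_sum_range' l (by omega), TensorProduct.sum_tmul]
    refine Finset.sum_congr rfl fun i _ => ?_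
    rw [tensorCoeff_tmul, ← TensorProduct.smul_tmul, ← Polynomial.C_mul_X_pow_eq_monomial,
      Polynomial.smul_eq_C_mul]
  | add x y hx hy =>
    obtain ⟨k, hk⟩ := hx
    obtain ⟨k', hk'⟩ := hy
    refine ⟨max k k', fun l hl => ?_⟩
    conv_lhs => rw [hk l (le_trans (le_max_left _ _) hl), hk' l (le_trans (le_max_right _ _) hl)]
    rw [← Finset.sum_add_distrib]
    simp only [map_add, TensorProduct.tmul_add]

variable {V : Type*} [AddCommGroup V] [Module A V] [Module A[X] V] [IsScalarTower A A[X] V]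

/-- The multiplication map `A[X] ⊗ B → V` of an `A`-submodule `B` of an `A[X]`-module `V`. -/
noncomputable def tensorMul (B : Submodule A V) : A[X] ⊗[A] B →ₗ[A[X]] V :=
  TensorProduct.AlgebraTensorModule.lift
    { toFun := fun a => a • B.subtype
      map_add' := fun a b => add_smul a b _
      map_smul' := fun a b => by simp [mul_smul] }

@[simp]
theorem tensorMul_tmul (B : Submodule A V) (a : A[X]) (b : B) :
    tensorMul B (a ⊗ₜ b) = a • (b : V) := rfl

/-- The map `a ⊗ b ↦ a X ⊗ b - a ⊗ X b`. -/
noncomputable def tensorShift {B' B : Submodule A V} (hle : B' ≤ B)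
    (hX : ∀ b ∈ B', (Polynomial.X : A[X]) • b ∈ B) : A[X] ⊗[A] B' →ₗ[A[X]] A[X] ⊗[A] B :=
  (Polynomial.X : A[X]) • (Submodule.inclusion hle).baseChange A[X] -
    (((Algebra.lsmul A A V (Polynomial.X : A[X])).restrict hX : B' →ₗ[A] B)).baseChange A[X]

@[simp]
theorem tensorShift_tmul {B' B : Submodule A V} (hle : B' ≤ B)
    (hX : ∀ b ∈ B', (Polynomial.X : A[X]) • b ∈ B) (a : A[X]) (b : B') :
    tensorShift hle hX (a ⊗ₜ b) =
      (Polynomial.X * a) ⊗ₜ[A] (⟨b, hle b.2⟩ : B) -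
        a ⊗ₜ[A] (⟨(Polynomial.X : A[X]) • (b : V), hX b b.2⟩ : B) := rfl

theorem tensorCoeff_tensorShift {B' B : Submodule A V} (hle : B' ≤ B)
    (hX : ∀ b ∈ B', (Polynomial.X : A[X]) • b ∈ B) (j : ℕ) (t : A[X] ⊗[A] B') :
    (tensorCoeff A B (j + 1) (tensorShift hle hX t) : V) =
      (tensorCoeff A B' j t : V) - (Polynomial.X : A[X]) • (tensorCoeff A B' (j + 1) t : V) := by
  induction t with
  | zero => simp
  | tmul a b =>
    have h : a.coeff (j + 1) • (Polynomial.X : A[X]) • (b : V) =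
        (Polynomial.X : A[X]) • a.coeff (j + 1) • (b : V) := smul_comm _ _ _
    simp [h]
  | add x y hx hy =>
    simp only [map_add, Submodule.coe_add, hx, hy, smul_add]
    abel

theorem tensorShift_injective {B' B : Submodule A V} (hle : B' ≤ B)
    (hX : ∀ b ∈ B', (Polynomial.X : A[X]) • b ∈ B) : Function.Injective (tensorShift hle hX) := by
  rw [injective_iff_map_eq_zero]
  intro t ht
  obtain ⟨k, hk⟩ := exists_eq_sum_tensorCoeff t
  have hz : ∀ j, k ≤ j → tensorCoeff A B' j t = 0 := fun j hj => by
    have h1 := hk j hj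
    have h2 := hk (j + 1) (by omega)
    rw [Finset.sum_range_succ, ← h1, left_eq_add] at h2
    simpa using congrArg (tensorCoeff A B' j) h2
  have hstep : ∀ j, tensorCoeff A B' (j + 1) t = 0 → tensorCoeff A B' j t = 0 := fun j hj => by
    have := tensorCoeff_tensorShift hle hX j t
    rw [ht, hj, map_zero] at this
    simpa using this.symm
  have hall : ∀ m j, k ≤ j + m → tensorCoeff A B' j t = 0 := by
    intro m
    induction m with
    | zero => exact fun j hj => hz j hj
    | succ m ih => exact fun j hj => hstep j (ih (j + 1) (by omega))
  rw [hk k le_rfl]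
  exact Finset.sum_eq_zero fun i _ => by rw [hall k i (by omega), TensorProduct.tmul_zero]

theorem tensorShift_exact {B' B : Submodule A V} (hle : B' ≤ B)
    (hX : ∀ b ∈ B', (Polynomial.X : A[X]) • b ∈ B)
    (hlead : ∀ (k : ℕ) (b : ℕ → B),
      ∑ i ∈ Finset.range (k + 2), (Polynomial.X ^ i : A[X]) • (b i : V) = 0 →
      (b (k + 1) : V) ∈ B') :
    Function.Exact (tensorShift hle hX) (tensorMul B) := by
  have hcomp : ∀ t, tensorMul B (tensorShift hle hX t) = 0 := fun t => by
    induction t with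
    | zero => simp
    | tmul a b => simp [← mul_smul, mul_comm]
    | add x y hx hy => rw [map_add, map_add, hx, hy, add_zero]
  have key : ∀ (k : ℕ) (b : ℕ → B),
      ∑ i ∈ Finset.range (k + 1), (Polynomial.X ^ i : A[X]) • (b i : V) = 0 →
      ∑ i ∈ Finset.range (k + 1), (Polynomial.X ^ i : A[X]) ⊗ₜ[A] b i ∈
        LinearMap.range (tensorShift hle hX) := by
    intro k
    induction k with
    | zero =>
      intro b hb
      have : b 0 = 0 := by simpa using hb
      simp [this]
    | succ k ih =>
      intro b hb
      have hk := hlead k b hb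
      have hb' := ih (Function.update b k
          (b k + ⟨(Polynomial.X : A[X]) • (b (k + 1) : V), hX _ hk⟩)) (by
        rw [Finset.sum_range_succ, Finset.sum_range_succ] at hb
        rw [Finset.sum_range_succ, Finset.sum_congr rfl fun i hi => by
          rw [Function.update_of_ne (Finset.mem_range.1 hi).ne]]
        rw [Function.update_self, Submodule.coe_add, smul_add, ← mul_smul, ← pow_succ, ← add_assoc]
        exact hb)
      have hsh := LinearMap.mem_range_self (tensorShift hle hX)
        ((Polynomial.X ^ k : A[X]) ⊗ₜ[A] (⟨b (k + 1), hk⟩ : B'))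
      have := add_mem hb' hsh
      rw [Finset.sum_range_succ, Finset.sum_congr rfl fun i hi => by
          rw [Function.update_of_ne (Finset.mem_range.1 hi).ne], Function.update_self,
          tensorShift_tmul, TensorProduct.tmul_add, ← pow_succ'] at this
      rw [Finset.sum_range_succ, Finset.sum_range_succ]
      convert this using 1
      abel
  intro t
  refine ⟨fun ht => ?_, ?_⟩
  · obtain ⟨k, hk⟩ := exists_eq_sum_tensorCoeff t
    have h := hk (k + 1) (by omega)
    rw [h]
    refine key k _ ?_
    rw [h, map_sum] at ht
    exact ht
  · rintro ⟨s, rfl⟩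
    exact hcomp s

end Polynomial

section Submodules

open Polynomial TensorProduct

/-- Every submodule of a free module of finite rank over `A` has a free resolution with terms
of finite rank, of constant rank from the `p`-th term on. -/
def SubmodulesHaveResolution (A : Type*) [CommRing A] (p : ℕ) : Prop :=
  ∀ (m : ℕ) (K : Submodule A (Fin m → A)),
    ∃ d : ℕ → ℕ, (∀ i, p ≤ i → d i = d p) ∧ HasFreeResolution A K d

namespace SubmodulesHaveResolution

variable {A : Type*} [CommRing A] {p : ℕ}

theorem of_injective (h : SubmodulesHaveResolution A p) {B : Type*} [AddCommGroup B] [Module A B]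
    {m : ℕ} (f : B →ₗ[A] (Fin m → A)) (hf : Function.Injective f) :
    ∃ d : ℕ → ℕ, (∀ i, p ≤ i → d i = d p) ∧ HasFreeResolution A B d := by
  obtain ⟨d, hd, hK⟩ := h m (LinearMap.range f)
  exact ⟨d, hd, hK.of_equiv (LinearEquiv.ofInjective f hf).symm⟩

theorem of_ringEquiv (h : SubmodulesHaveResolution A p) {B : Type*} [CommRing B] (σ : A ≃+* B) :
    SubmodulesHaveResolution B p := by
  intro m K
  let e : (Fin m → A) ≃+ (Fin m → B) := AddEquiv.piCongrRight fun _ => σ.toAddEquiv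
  have he : ∀ a x, e (a • x) = σ a • e x := fun a x => by
    ext j; simp [e]
  let K' : Submodule A (Fin m → A) :=
    { carrier := {x | e x ∈ K}
      add_mem' := fun {x y} hx hy => by
        simpa only [Set.mem_ofPred_eq, map_add] using K.add_mem hx hy
      zero_mem' := by simp
      smul_mem' := fun a x hx => by
        simpa only [Set.mem_ofPred_eq, he] using K.smul_mem (σ a) hx }
  obtain ⟨d, hd, hK⟩ := h m K'
  let φ : K' ≃+ K :=
    { e.toEquiv.subtypeEquiv (fun x => Iff.rfl : ∀ x, x ∈ K' ↔ e.toEquiv x ∈ K) with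
      map_add' := fun x y => Subtype.ext (map_add e x.1 y.1) }
  exact ⟨d, hd, hK.of_ringEquiv σ φ fun a x => Subtype.ext (he a x.1)⟩

theorem polynomial [IsNoetherianRing A] (h : SubmodulesHaveResolution A p) :
    SubmodulesHaveResolution A[X] (p + 1) := by
  intro m K
  let B : ℕ → Submodule A (Fin m → A[X]) := fun s =>
    K.restrictScalars A ⊓ Submodule.pi Set.univ fun _ => degreeLT A s
  have hB : ∀ s v, v ∈ B s ↔ v ∈ K ∧ ∀ j l, s ≤ l → (v j).coeff l = 0 := fun s v => by
    simp [B, Submodule.mem_pi, mem_degreeLT, degree_lt_iff_coeff_zero]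
  have hres : ∀ s, ∃ d : ℕ → ℕ, (∀ i, p ≤ i → d i = d p) ∧ HasFreeResolution A (B s) d := by
    intro s
    refine h.of_injective (m := m * s) ((LinearMap.pi fun k =>
      lcoeff A (finProdFinEquiv.symm k).2 ∘ₗ LinearMap.proj (finProdFinEquiv.symm k).1) ∘ₗ
        (B s).subtype) ?_
    rw [injective_iff_map_eq_zero]
    intro v hv
    ext j l
    rcases lt_or_ge l s with hl | hl
    · have h1 : ((v : Fin m → A[X]) (finProdFinEquiv.symm (finProdFinEquiv (j, ⟨l, hl⟩))).1).coeff
          (finProdFinEquiv.symm (finProdFinEquiv (j, (⟨l, hl⟩ : Fin s)))).2 = 0 := congrFun hv _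
      rwa [Equiv.symm_apply_apply] at h1
    · exact ((hB s _).1 v.2).2 j l hl
  obtain ⟨G, hG⟩ := (inferInstance : IsNoetherian A[X] (Fin m → A[X])).noetherian K
  let s := G.sup fun v => Finset.univ.sup fun j => (v j).natDegree
  have hs : ∀ v ∈ G, v ∈ B (s + 1) := by
    intro v hv
    refine (hB _ _).2 ⟨hG ▸ Submodule.subset_span hv, fun j l hl => coeff_eq_zero_of_natDegree_lt ?_⟩
    have h1 : (v j).natDegree ≤ Finset.univ.sup fun j => (v j).natDegree :=
      Finset.le_sup (f := fun j => (v j).natDegree) (Finset.mem_univ j)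
    have h2 : (Finset.univ.sup fun j => (v j).natDegree) ≤ s :=
      Finset.le_sup (f := fun v : Fin m → A[X] => Finset.univ.sup fun j => (v j).natDegree) hv
    omega
  have hrange : LinearMap.range (tensorMul (B (s + 1))) = K := by
    apply le_antisymm
    · rintro _ ⟨t, rfl⟩
      induction t with
      | zero => simp
      | tmul a b => exact K.smul_mem a b.2.1
      | add x y hx hy => rw [map_add]; exact K.add_mem hx hy
    · conv_lhs => rw [← hG]
      refine Submodule.span_le.2 fun v hv => ⟨1 ⊗ₜ ⟨v, hs v hv⟩, ?_⟩
      rw [tensorMul_tmul, one_smul]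
  have hle : B s ≤ B (s + 1) := fun v hv => by
    rw [hB] at hv ⊢
    exact ⟨hv.1, fun j l hl => hv.2 j l (by omega)⟩
  have hX : ∀ b ∈ B s, (Polynomial.X : A[X]) • b ∈ B (s + 1) := fun v hv => by
    rw [hB] at hv ⊢
    refine ⟨K.smul_mem _ hv.1, fun j l hl => ?_⟩
    obtain ⟨l, rfl⟩ : ∃ l', l = l' + 1 := ⟨l - 1, by omega⟩
    simpa using hv.2 j l (by omega)
  have hlead : ∀ (k : ℕ) (b : ℕ → B (s + 1)),
      ∑ i ∈ Finset.range (k + 2), (Polynomial.X ^ i : A[X]) • (b i : Fin m → A[X]) = 0 →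
      (b (k + 1) : Fin m → A[X]) ∈ B s := by
    intro k b hb
    have hb' := fun i => (hB _ _).1 (b i).2
    refine (hB _ _).2 ⟨(hb' (k + 1)).1, fun j l hl => ?_⟩
    rcases hl.eq_or_lt with rfl | hl
    · have h1 := congrArg (fun q : A[X] => q.coeff (s + (k + 1))) (congrFun hb j)
      simp only [Finset.sum_apply, Pi.smul_apply, smul_eq_mul, finsetSum_coeff, Pi.zero_apply,
        Polynomial.coeff_zero, coeff_X_pow_mul'] at h1
      rw [Finset.sum_range_succ, Finset.sum_eq_zero, zero_add, if_pos (by omega),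
        Nat.add_sub_cancel] at h1
      · exact h1
      · intro i hi
        rw [Finset.mem_range] at hi
        rw [if_pos (by omega)]
        exact (hb' i).2 j _ (by omega)
    · exact (hb' (k + 1)).2 j l hl
  obtain ⟨a, ha, hRa⟩ := hres s
  obtain ⟨b, hb, hRb⟩ := hres (s + 1)
  have hexact := tensorShift_exact hle hX hlead
  refine ⟨_, ?_, ((hRa.baseChange A[X]).cokernel (tensorShift hle hX)
    (tensorMul (B (s + 1))).rangeRestrict (tensorShift_injective hle hX)
    (LinearMap.surjective_rangeRestrict _) ?_ (hRb.baseChange A[X])).of_equiv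
      (LinearEquiv.ofEq _ _ hrange)⟩
  · rintro (_ | i) hi
    · omega
    · change b (i + 1) + a i = b (p + 1) + a p
      rw [ha i (by omega), hb (i + 1) (by omega), hb (p + 1) (by omega)]
  · rw [LinearMap.exact_iff, LinearMap.ker_rangeRestrict, hexact.linearMap_ker_eq]

theorem mvPolynomial [IsNoetherianRing A] (h : SubmodulesHaveResolution A p) (n : ℕ) :
    SubmodulesHaveResolution (MvPolynomial (Fin n) A) (p + n) := by
  induction n with
  | zero => exact h.of_ringEquiv (MvPolynomial.isEmptyRingEquiv A (Fin 0)).symm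
  | succ n ih => exact ih.polynomial.of_ringEquiv (MvPolynomial.finSuccEquiv A n).symm.toRingEquiv

/-- A principal ideal ring in which every principal ideal has a resolution by free modules of
rank one. -/
theorem of_isPrincipalIdealRing [IsPrincipalIdealRing A]
    (hA : ∀ d : A, ∃ e h : A, (∀ x, d * x = 0 ↔ e ∣ x) ∧ (∀ x, e * x = 0 ↔ h ∣ x) ∧
      ∀ x, h * x = 0 ↔ e ∣ x) :
    SubmodulesHaveResolution A 0 := by
  have hideal : ∀ I : Ideal A, HasFreeResolution A I fun _ => 1 := by
    intro I
    obtain ⟨d, rfl⟩ := (IsPrincipalIdealRing.principal I).principal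
    obtain ⟨e, h, hd, he, hh⟩ := hA d
    have hrk : ∀ a b : A, (∀ x, b * x = 0 ↔ a ∣ x) →
        LinearMap.range (a • LinearMap.id : (Fin 1 → A) →ₗ[A] (Fin 1 → A)) =
          LinearMap.ker (b • LinearMap.id : (Fin 1 → A) →ₗ[A] (Fin 1 → A)) := by
      intro a b hab
      ext x
      have h1 : b • x = 0 ↔ b * x 0 = 0 := by simp [funext_iff]
      simp only [LinearMap.mem_range, LinearMap.mem_ker, LinearMap.smul_apply, LinearMap.id_apply,
        h1, hab]
      constructor
      · rintro ⟨y, rfl⟩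
        exact ⟨y 0, rfl⟩
      · rintro ⟨c, hc⟩
        exact ⟨fun _ => c, by ext j; rw [Subsingleton.elim j 0, hc]; rfl⟩
    let ε : (Fin 1 → A) →ₗ[A] (A ∙ d) :=
      (d • LinearMap.proj 0 : (Fin 1 → A) →ₗ[A] A).codRestrict _ fun x =>
        Submodule.mem_span_singleton.2 ⟨x 0, by simp [mul_comm]⟩
    refine ⟨fun i => if Even i then e • LinearMap.id else h • LinearMap.id, ε, ?_, ?_, fun i => ?_⟩
    · rintro ⟨y, hy⟩
      obtain ⟨c, rfl⟩ := Submodule.mem_span_singleton.1 hy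
      exact ⟨fun _ => c, Subtype.ext (mul_comm d c)⟩
    · simp only [if_pos Even.zero]
      rw [hrk e d hd]
      ext x
      simp [ε, LinearMap.ker_codRestrict, funext_iff]
    · rcases Nat.even_or_odd i with hi | hi
      · simp only [if_pos hi, if_neg (Nat.not_even_iff_odd.2 hi.add_one)]
        exact hrk h e he
      · simp only [if_neg (Nat.not_even_iff_odd.2 hi), if_pos hi.add_one]
        exact hrk e h hh
  intro m
  induction m with
  | zero =>
    intro K
    refine ⟨fun _ => 0, fun _ _ => rfl, fun _ => 0, 0, fun x => ⟨0, Subsingleton.elim _ _⟩, ?_,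
      fun _ => ?_⟩ <;> exact Subsingleton.elim _ _
  | succ m ih =>
    intro K
    let q : K →ₗ[A] A := LinearMap.proj 0 ∘ₗ K.subtype
    let r : LinearMap.ker q →ₗ[A] (Fin m → A) :=
      LinearMap.funLeft A A Fin.succ ∘ₗ K.subtype ∘ₗ (LinearMap.ker q).subtype
    have hr : Function.Injective r := by
      rw [injective_iff_map_eq_zero]
      intro x hx
      ext j
      refine Fin.cases ?_ (fun j => congrFun hx j) j
      exact LinearMap.mem_ker.1 x.2
    obtain ⟨d, hd, hK⟩ := ih (LinearMap.range r)
    have hq : HasFreeResolution A (LinearMap.ker q) d :=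
      hK.of_equiv (LinearEquiv.ofInjective r hr).symm
    have hex : Function.Exact (LinearMap.ker q).subtype q.rangeRestrict := by
      rw [LinearMap.exact_iff, LinearMap.ker_rangeRestrict, Submodule.range_subtype]
    exact ⟨fun i => d i + 1, fun i hi => congrArg (· + 1) (hd i hi),
      .of_exact (LinearMap.ker q).subtype q.rangeRestrict (Submodule.injective_subtype _)
        (LinearMap.surjective_rangeRestrict _) hex
        hq (hideal _)⟩

/-- A finitely generated module is resolved by a free module of finite rank followed by a
resolution of the kernel. -/
theorem hasEventuallyConstantFreeResolution (h : SubmodulesHaveResolution A p) (M : Type*)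
    [AddCommGroup M] [Module A M] [Module.Finite A M] :
    HasEventuallyConstantFreeResolution A M (p + 1) := by
  obtain ⟨m, f, hf⟩ := Module.Finite.exists_fin' A M
  obtain ⟨d, hd, hK⟩ := h m (LinearMap.ker f)
  obtain ⟨g, ε, hg⟩ := hK.of_ker f hf
  refine ⟨_, g, ε, ?_, hg⟩
  rintro (_ | i) hi
  · omega
  · exact hd i (by omega)

end SubmodulesHaveResolution

theorem exists_annihilator_generators {R : Type*} [CommRing R] [IsDomain R]
    [IsPrincipalIdealRing R] (N : R) (d : R ⧸ Ideal.span {N}) :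
    ∃ e h : R ⧸ Ideal.span {N}, (∀ x, d * x = 0 ↔ e ∣ x) ∧ (∀ x, e * x = 0 ↔ h ∣ x) ∧
      ∀ x, h * x = 0 ↔ e ∣ x := by
  obtain ⟨d, rfl⟩ := Ideal.Quotient.mk_surjective d
  by_cases hN : N = 0
  · subst hN
    have hinj : ∀ x : R, Ideal.Quotient.mk (Ideal.span {(0 : R)}) x = 0 ↔ x = 0 := fun x => by
      rw [Ideal.Quotient.eq_zero_iff_mem, Ideal.mem_span_singleton, zero_dvd_iff]
    by_cases hd : d = 0
    · exact ⟨1, 0, by simp [hd], by simp, by simp⟩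
    · refine ⟨0, 1, fun x => ?_, by simp, by simp⟩
      obtain ⟨x, rfl⟩ := Ideal.Quotient.mk_surjective x
      rw [← map_mul, hinj, zero_dvd_iff, hinj, mul_eq_zero, or_iff_right hd]
  · obtain ⟨g, hg⟩ := (IsPrincipalIdealRing.principal (Ideal.span {d, N})).principal
    replace hg : Ideal.span {d, N} = Ideal.span {g} := hg
    obtain ⟨d', hd'⟩ : g ∣ d := Ideal.mem_span_singleton.1 (hg ▸ Ideal.subset_span (by simp))
    obtain ⟨e, he⟩ : g ∣ N := Ideal.mem_span_singleton.1 (hg ▸ Ideal.subset_span (by simp))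
    obtain ⟨u, v, huv⟩ : ∃ u v, u * d + v * N = g :=
      Ideal.mem_span_pair.1 (hg ▸ Ideal.mem_span_singleton_self g)
    have hg0 : g ≠ 0 := fun h => hN (by rw [he, h, zero_mul])
    have he0 : e ≠ 0 := fun h => hN (by rw [he, h, mul_zero])
    have hmk : ∀ x : R, Ideal.Quotient.mk (Ideal.span {N}) x = 0 ↔ N ∣ x := fun x => by
      rw [Ideal.Quotient.eq_zero_iff_mem, Ideal.mem_span_singleton]
    have hmul : ∀ a b : R, a ≠ 0 → N = a * b → ∀ x : R ⧸ Ideal.span {N},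
        Ideal.Quotient.mk _ a * x = 0 ↔ Ideal.Quotient.mk _ b ∣ x := by
      intro a b ha hab x
      constructor
      · obtain ⟨x, rfl⟩ := Ideal.Quotient.mk_surjective x
        rw [← map_mul, hmk, hab, mul_dvd_mul_iff_left ha]
        exact map_dvd _
      · rintro ⟨y, rfl⟩
        rw [← mul_assoc, ← map_mul, ← hab, (hmk N).2 dvd_rfl, zero_mul]
    refine ⟨Ideal.Quotient.mk _ e, Ideal.Quotient.mk _ g, fun x => ?_,
      hmul e g he0 (by rw [he, mul_comm]), hmul g e hg0 he⟩
    rw [← hmul g e hg0 he]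
    constructor
    · intro h
      rw [← huv, map_add, map_mul, map_mul, (hmk N).2 dvd_rfl, mul_zero, add_zero, mul_assoc, h,
        mul_zero]
    · intro h
      rw [hd', map_mul, mul_right_comm, h, zero_mul]

end Submodules

end PaperGB

/-- Hilbert's syzygy theorem for a finite direct product of quotients of
PIDs: every finitely generated module over `R[x_1,…,x_n]`, where
`R = ∏_{i=1}^{t} R_i/N_iR_i`, has an infinite free resolution by finitely generated
free modules which is constant from stage `p ≤ n+1` on. -/
theorem hilbert_syzygy_finite_product
    {n t : ℕ} (Rr : Fin t → Type*) [∀ i, CommRing (Rr i)] [∀ i, IsDomain (Rr i)]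
    [∀ i, IsPrincipalIdealRing (Rr i)]
    (Nn : ∀ i, Rr i) (hNu : ∀ i, ¬ IsUnit (Nn i))
    (M : Type*) [AddCommGroup M]
    [Module (MvPolynomial (Fin n) (∀ i, Rr i ⧸ Ideal.span {Nn i})) M]
    [Module.Finite (MvPolynomial (Fin n) (∀ i, Rr i ⧸ Ideal.span {Nn i})) M] :
    ∃ p ≤ n + 1, HasEventuallyConstantFreeResolution
      (MvPolynomial (Fin n) (∀ i, Rr i ⧸ Ideal.span {Nn i})) M p := by
  have : ∀ i, IsPrincipalIdealRing (Rr i ⧸ Ideal.span {Nn i}) := fun i =>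
    IsPrincipalIdealRing.of_surjective (Ideal.Quotient.mk _) Ideal.Quotient.mk_surjective
  have h : SubmodulesHaveResolution (∀ i, Rr i ⧸ Ideal.span {Nn i}) 0 := by
    refine .of_isPrincipalIdealRing fun d => ?_
    choose e h hd he hh using fun i => exists_annihilator_generators (Nn i) (d i)
    refine ⟨e, h, fun x => ?_, fun x => ?_, fun x => ?_⟩ <;>
      simp only [funext_iff, pi_dvd_iff, Pi.mul_apply, Pi.zero_apply, hd, he, hh]
  exact ⟨0 + n + 1, by omega, (h.mvPolynomial n).hasEventuallyConstantFreeResolution M⟩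
end

section
/- Let R = ∏_{i=1}^{t} R_i/N_iR_i, where each R_i is a principal ideal domain and each N_i ∈ R_i is not a unit (N_i may be zero), let S = R[x_1,…,x_n] with a fixed monomial order, and let I be an ideal of S. If I admits a Gröbner basis {f_1,…,f_m} all of whose leading coefficients lc(f_i) are nonzerodivisors in R, then there exist p ≤ n+1, finitely generated free S-modules F_0,…,F_p, and an exact sequence 0 → F_p → F_{p−1} → ⋯ → F_0 → S/I → 0 of S-modules. -/
open MvPolynomial
open scoped MonomialOrder

open PaperGB

namespace PaperGB

section Resolution

variable {S : Type*} [CommRing S] {M : Type*} [AddCommGroup M] [Module S M]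

theorem HasFiniteFreeResolutionOfLength.of_linearEquiv {d : ℕ} (e : (Fin d → S) ≃ₗ[S] M) :
    HasFiniteFreeResolutionOfLength S M 0 := by
  refine ⟨fun i => Nat.casesOn i d fun _ => 0, fun _ => 0, e.toLinearMap, ?_, e.surjective, ?_, ?_⟩
  · rintro (_ | i) hi
    · omega
    · rfl
  · rw [LinearMap.range_zero, LinearEquiv.ker]
  · intro i
    rw [LinearMap.range_zero, LinearMap.ker_zero]
    refine (Submodule.eq_bot_iff _).2 (fun x _ => ?_) |>.symm
    exact funext fun j => j.elim0

theorem HasFiniteFreeResolutionOfLength.succ {d p : ℕ} {π : (Fin d → S) →ₗ[S] M}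
    (hπ : Function.Surjective π)
    (h : HasFiniteFreeResolutionOfLength S (LinearMap.ker π) p) :
    HasFiniteFreeResolutionOfLength S M (p + 1) := by
  obtain ⟨e, g, ε, he, hε, hgε, hg⟩ := h
  refine ⟨fun i => Nat.casesOn i d e,
    fun i => match i with
      | 0 => (LinearMap.ker π).subtype ∘ₗ ε
      | i + 1 => g i, π, ?_, hπ, ?_, ?_⟩
  · rintro (_ | i) hi
    · omega
    · exact he i (by omega)
  · change LinearMap.range ((LinearMap.ker π).subtype ∘ₗ ε) = LinearMap.ker π
    rw [LinearMap.range_comp, LinearMap.range_eq_top.2 hε, Submodule.map_top,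
      Submodule.range_subtype]
  · rintro (_ | i)
    · change LinearMap.range (g 0) = LinearMap.ker ((LinearMap.ker π).subtype ∘ₗ ε)
      rw [LinearMap.ker_comp_of_ker_eq_bot _ (Submodule.ker_subtype _), hgε]
    · exact hg i

theorem HasFiniteFreeResolutionOfLength.congr {N : Type*} [AddCommGroup N] [Module S N] {p : ℕ}
    (e : M ≃ₗ[S] N) (h : HasFiniteFreeResolutionOfLength S M p) :
    HasFiniteFreeResolutionOfLength S N p := by
  obtain ⟨d, g, ε, hd, hε, hgε, hg⟩ := h
  refine ⟨d, g, e.toLinearMap ∘ₗ ε, hd, e.surjective.comp hε, ?_, hg⟩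
  rw [hgε, LinearMap.ker_comp_of_ker_eq_bot _ e.ker]

theorem HasFiniteFreeResolutionOfLength.succ_of_fintype {κ : Type*} [Fintype κ] {p : ℕ}
    {π : (κ → S) →ₗ[S] M} (hπ : Function.Surjective π)
    (h : HasFiniteFreeResolutionOfLength S (LinearMap.ker π) p) :
    HasFiniteFreeResolutionOfLength S M (p + 1) := by
  let e : (Fin (Fintype.card κ) → S) ≃ₗ[S] (κ → S) :=
    LinearEquiv.funCongrLeft S S (Fintype.equivFin κ)
  refine HasFiniteFreeResolutionOfLength.succ (π := π ∘ₗ e.toLinearMap)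
    (hπ.comp e.surjective) (h.congr ?_)
  refine (e.symm.submoduleMap (LinearMap.ker π)).trans (LinearEquiv.ofEq _ _ ?_)
  ext x
  simp

end Resolution

section LeadingFamily

variable {n : ℕ} {R : Type*} [CommRing R] {ι κ W K : Type*} [LinearOrder W] [LinearOrder K]

/-- The vectors of polynomials all of whose terms `x ^ b` in position `i` have weight
`D i b ≤ w`. -/
noncomputable def termFiltration (R : Type*) [CommRing R] (D : ι → (Fin n →₀ ℕ) → W) (w : W) :
    Submodule R (ι → MvPolynomial (Fin n) R) where
  carrier := {u | ∀ i b, w < D i b → coeff b (u i) = 0}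
  add_mem' hu hv i b hb := by simp [hu i b hb, hv i b hb]
  zero_mem' i b _ := by simp
  smul_mem' r u hu i b hb := by simp [hu i b hb]

theorem termFiltration_mono (D : ι → (Fin n →₀ ℕ) → W) {w w' : W} (h : w ≤ w') :
    termFiltration R D w ≤ termFiltration R D w' :=
  fun _ hu i b hb => hu i b (h.trans_lt hb)

/-- `D` orders the terms `x ^ b` in position `i` compatibly with multiplication by monomials. -/
structure IsTermOrder (D : ι → (Fin n →₀ ℕ) → W) : Prop where
  inj : ∀ i b i' b', D i b = D i' b' → i = i' ∧ b = b'
  add_lt : ∀ i b i' b' e, D i b < D i' b' → D i (e + b) < D i' (e + b')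

theorem IsTermOrder.add_le {D : ι → (Fin n →₀ ℕ) → W} (hD : IsTermOrder D) {i i' : ι}
    {b b' : Fin n →₀ ℕ} (e : Fin n →₀ ℕ) (h : D i b ≤ D i' b') :
    D i (e + b) ≤ D i' (e + b') := by
  rcases h.lt_or_eq with h | h
  · exact (hD.add_lt _ _ _ _ _ h).le
  · obtain ⟨rfl, rfl⟩ := hD.inj _ _ _ _ h
    exact le_rfl

theorem exists_leading_term [Fintype ι] (D : ι → (Fin n →₀ ℕ) → W)
    {u : ι → MvPolynomial (Fin n) R} (hu : u ≠ 0) :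
    ∃ i b, coeff b (u i) ≠ 0 ∧ u ∈ termFiltration R D (D i b) := by
  classical
  let s : Finset (Σ _ : ι, Fin n →₀ ℕ) := Finset.univ.sigma fun i => (u i).support
  have hs : s.Nonempty := by
    obtain ⟨i, hi⟩ := Function.ne_iff.1 hu
    obtain ⟨b, hb⟩ := MvPolynomial.ne_zero_iff.1 hi
    exact ⟨⟨i, b⟩, by simpa [s] using hb⟩
  obtain ⟨⟨i, b⟩, hib, hmax⟩ := s.exists_max_image (fun x => D x.1 x.2) hs
  refine ⟨i, b, by simpa [s] using hib, fun i' b' h => ?_⟩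
  by_contra hc
  exact h.not_ge (hmax ⟨i', b'⟩ (by simpa [s] using hc))

/-- The weights on the syzygies of a family with leading terms `x ^ (a l)` in position `p l`,
with ties broken by `key`. -/
noncomputable def schreyerOrder (D : ι → (Fin n →₀ ℕ) → W) (p : κ → ι) (a : κ → Fin n →₀ ℕ) (key : κ → K)
    (l : κ) (b : Fin n →₀ ℕ) : W ×ₗ K :=
  toLex (D (p l) (a l + b), key l)

theorem IsTermOrder.schreyerOrder {D : ι → (Fin n →₀ ℕ) → W} (hD : IsTermOrder D) (p : κ → ι)
    (a : κ → Fin n →₀ ℕ) {key : κ → K} (hkey : Function.Injective key) :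
    IsTermOrder (schreyerOrder D p a key) where
  inj l b l' b' h := by
    have h := Prod.ext_iff.1 (toLex.injective h)
    obtain rfl := hkey h.2
    exact ⟨rfl, add_left_cancel (hD.inj _ _ _ _ h.1).2⟩
  add_lt l b l' b' e h := by
    rw [PaperGB.schreyerOrder, PaperGB.schreyerOrder, Prod.Lex.toLex_lt_toLex] at h ⊢
    rcases h with h | ⟨h, h'⟩
    · left
      simpa only [add_left_comm] using hD.add_lt _ _ _ _ e h
    · right
      refine ⟨?_, h'⟩
      obtain ⟨h1, h2⟩ := hD.inj _ _ _ _ h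
      dsimp only at h1 h2 ⊢
      rw [h1, add_left_comm, h2, add_left_comm]

/-- `f` is a family of elements of `U` with leading terms `c l * x ^ (a l)` in position `p l`,
with regular coefficients, generating all leading terms of `U`. -/
structure IsLeadingFamily (D : ι → (Fin n →₀ ℕ) → W)
    (U : Submodule (MvPolynomial (Fin n) R) (ι → MvPolynomial (Fin n) R))
    (p : κ → ι) (a : κ → Fin n →₀ ℕ) (c : κ → R) (f : κ → ι → MvPolynomial (Fin n) R) :
    Prop where
  mem : ∀ l, f l ∈ U
  le : ∀ l, f l ∈ termFiltration R D (D (p l) (a l))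
  coeff_eq : ∀ l, coeff (a l) (f l (p l)) = c l
  regular : ∀ l, c l ∈ nonZeroDivisors R
  gen : ∀ u ∈ U, ∀ i b, u ∈ termFiltration R D (D i b) →
    coeff b (u i) ∈ Ideal.span (c '' {l | p l = i ∧ a l ≤ b})

theorem exists_sum_of_mem_span_image [Fintype κ] {c : κ → R} {s : Set κ} {x : R}
    (hx : x ∈ Ideal.span (c '' s)) :
    ∃ r : κ → R, (∀ l, l ∉ s → r l = 0) ∧ ∑ l, r l * c l = x := by
  obtain ⟨r, hr, rfl⟩ := (Finsupp.mem_span_image_iff_linearCombination R).1 hx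
  refine ⟨r, fun l hl => ?_, ?_⟩
  · by_contra h
    exact hl (hr (by simpa using h))
  · rw [Finsupp.linearCombination_apply, Finsupp.sum_fintype _ _ (by simp)]
    rfl

theorem exists_regular_generator [IsPrincipalIdealRing R] (I : Ideal R) {x : R} (hx : x ∈ I)
    (hr : x ∈ nonZeroDivisors R) : ∃ g ∈ nonZeroDivisors R, I = Ideal.span {g} := by
  obtain ⟨g, hg⟩ := (IsPrincipalIdealRing.principal I).principal
  refine ⟨g, ?_, hg⟩
  rw [hg] at hx
  obtain ⟨y, rfl⟩ := Ideal.mem_span_singleton.1 hx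
  exact (mul_mem_nonZeroDivisors.1 hr).1

section Syzygy

variable [Fintype κ] {D : ι → (Fin n →₀ ℕ) → W} {p : κ → ι} {a : κ → Fin n →₀ ℕ} {c : κ → R}
  {f : κ → ι → MvPolynomial (Fin n) R} {q : κ → MvPolynomial (Fin n) R}

theorem linearCombination_mem_termFiltration (hD : IsTermOrder D)
    (hf : ∀ l, f l ∈ termFiltration R D (D (p l) (a l))) {w : W}
    (hq : q ∈ termFiltration R (fun l b => D (p l) (a l + b)) w) :
    Fintype.linearCombination (MvPolynomial (Fin n) R) f q ∈ termFiltration R D w := by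
  classical
  intro i b hb
  rw [Fintype.linearCombination_apply, Finset.sum_apply, coeff_sum]
  refine Finset.sum_eq_zero fun l _ => ?_
  rw [Pi.smul_apply, smul_eq_mul, coeff_mul]
  refine Finset.sum_eq_zero fun x hx => ?_
  rw [Finset.HasAntidiagonal.mem_antidiagonal] at hx
  by_cases h1 : w < D (p l) (a l + x.1)
  · rw [hq l _ h1, zero_mul]
  · rw [hf l i x.2, mul_zero]
    by_contra h2
    have h3 := hD.add_le x.1 (not_lt.1 h2)
    rw [hx, add_comm] at h3
    exact hb.not_ge (h3.trans (not_lt.1 h1))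

open Classical in
theorem coeff_linearCombination (hD : IsTermOrder D)
    (hf : ∀ l, f l ∈ termFiltration R D (D (p l) (a l)))
    (hc : ∀ l, coeff (a l) (f l (p l)) = c l) {i : ι} {b : Fin n →₀ ℕ}
    (hq : q ∈ termFiltration R (fun l b => D (p l) (a l + b)) (D i b)) :
    coeff b (Fintype.linearCombination (MvPolynomial (Fin n) R) f q i) =
      ∑ l, if p l = i ∧ a l ≤ b then coeff (b - a l) (q l) * c l else 0 := by
  rw [Fintype.linearCombination_apply, Finset.sum_apply, coeff_sum]
  refine Finset.sum_congr rfl fun l _ => ?_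
  rw [Pi.smul_apply, smul_eq_mul, coeff_mul]
  have key : ∀ x ∈ Finset.HasAntidiagonal.antidiagonal b, coeff x.1 (q l) * coeff x.2 (f l i) ≠ 0 →
      p l = i ∧ a l = x.2 := by
    intro x hx h
    rw [Finset.HasAntidiagonal.mem_antidiagonal] at hx
    have h1 : D (p l) (a l + x.1) ≤ D i b :=
      not_lt.1 fun h1 => h (by rw [hq l _ h1, zero_mul])
    have h2 : D i x.2 ≤ D (p l) (a l) :=
      not_lt.1 fun h2 => h (by rw [hf l _ _ h2, mul_zero])
    have h3 := hD.add_le x.1 h2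
    rw [hx, add_comm x.1] at h3
    obtain ⟨h4, h5⟩ := hD.inj _ _ _ _ (h1.antisymm h3)
    refine ⟨h4, ?_⟩
    rw [← hx, add_comm] at h5
    exact add_left_cancel h5
  split_ifs with h
  · obtain ⟨rfl, hab⟩ := h
    rw [Finset.sum_eq_single (b - a l, a l), hc]
    · intro x hx hne
      by_contra h
      obtain ⟨-, h⟩ := key x hx h
      refine hne (Prod.ext ?_ h.symm)
      rw [Finset.HasAntidiagonal.mem_antidiagonal] at hx
      rw [← hx, h, add_tsub_cancel_right]
    · intro h
      exact absurd (Finset.HasAntidiagonal.mem_antidiagonal.2 (tsub_add_cancel_of_le hab)) h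
  · refine Finset.sum_eq_zero fun x hx => ?_
    by_contra hne
    obtain ⟨h1, h2⟩ := key x hx hne
    refine h ⟨h1, ?_⟩
    rw [Finset.HasAntidiagonal.mem_antidiagonal] at hx
    rw [h2, ← hx]
    exact le_add_self

omit [Fintype κ] in
theorem monomial_mem_termFiltration {i : ι} {b : Fin n →₀ ℕ} {r : κ → R}
    (hr : ∀ l, l ∉ {l | p l = i ∧ a l ≤ b} → r l = 0) :
    (fun l => monomial (b - a l) (r l)) ∈
      termFiltration R (fun l b => D (p l) (a l + b)) (D i b) := by
  classical
  intro l b' hb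
  rw [coeff_monomial]
  split_ifs with h
  · by_contra hne
    obtain ⟨h1, h2⟩ := not_imp_comm.1 (hr l) hne
    subst h h1
    dsimp only at hb
    rw [add_tsub_cancel_of_le h2] at hb
    exact hb.false
  · rfl

variable [Fintype ι] [WellFoundedLT W]
  {U : Submodule (MvPolynomial (Fin n) R) (ι → MvPolynomial (Fin n) R)}

theorem IsLeadingFamily.exists_standard_representation (hD : IsTermOrder D)
    (h : IsLeadingFamily D U p a c f) (w : W) :
    ∀ u ∈ U, u ∈ termFiltration R D w →
      ∃ q ∈ termFiltration R (fun l b => D (p l) (a l + b)) w,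
        Fintype.linearCombination (MvPolynomial (Fin n) R) f q = u := by
  classical
  induction w using WellFoundedLT.induction with
  | ind w ih =>
    intro u huU huw
    by_cases hu0 : u = 0
    · exact ⟨0, zero_mem _, by rw [map_zero, hu0]⟩
    obtain ⟨i, b, hib, hu⟩ := exists_leading_term D hu0
    have hw : D i b ≤ w := not_lt.1 fun hlt => hib (huw i b hlt)
    obtain ⟨r, hr, hrsum⟩ := exists_sum_of_mem_span_image (h.gen u huU i b hu)
    have hq := monomial_mem_termFiltration (D := D) hr
    set q : κ → MvPolynomial (Fin n) R := fun l => monomial (b - a l) (r l) with hqdef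
    have hcoeff := coeff_linearCombination hD h.le h.coeff_eq hq
    have hπ := linearCombination_mem_termFiltration hD h.le hq
    set v := Fintype.linearCombination (MvPolynomial (Fin n) R) f q with hv
    have hvU : v ∈ U := by
      rw [hv, Fintype.linearCombination_apply]
      exact Submodule.sum_mem _ fun l _ => Submodule.smul_mem _ _ (h.mem l)
    have hveq : coeff b (v i) = coeff b (u i) := by
      rw [hcoeff, ← hrsum]
      refine Finset.sum_congr rfl fun l _ => ?_
      split_ifs with hl
      · simp [hqdef]
      · rw [hr l hl, zero_mul]
    by_cases hd : u - v = 0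
    · exact ⟨q, termFiltration_mono _ hw hq, (sub_eq_zero.1 hd).symm⟩
    obtain ⟨i', b', hne, hd'⟩ := exists_leading_term D hd
    have hlt : D i' b' < D i b := by
      refine lt_of_le_of_ne (not_lt.1 fun hlt => hne ((sub_mem hu hπ) i' b' hlt)) fun he => hne ?_
      obtain ⟨rfl, rfl⟩ := hD.inj _ _ _ _ he
      simp [hveq]
    obtain ⟨q', hq', hq'v⟩ := ih _ (hlt.trans_le hw) (u - v) (sub_mem huU hvU) hd'
    refine ⟨q + q', add_mem (termFiltration_mono _ hw hq)
      (termFiltration_mono _ (hlt.le.trans hw) hq'), ?_⟩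
    rw [map_add, hq'v, ← hv, add_sub_cancel]

theorem IsLeadingFamily.exists_standard_representation_lt (hD : IsTermOrder D)
    (h : IsLeadingFamily D U p a c f) {i : ι} {b : Fin n →₀ ℕ}
    {u : ι → MvPolynomial (Fin n) R} (hu : u ∈ U)
    (hw : u ∈ termFiltration R D (D i b)) (h0 : coeff b (u i) = 0) :
    ∃ q : κ → MvPolynomial (Fin n) R,
      (∀ l b', D i b ≤ D (p l) (a l + b') → coeff b' (q l) = 0) ∧
        Fintype.linearCombination (MvPolynomial (Fin n) R) f q = u := by
  by_cases hu0 : u = 0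
  · exact ⟨0, by simp, by rw [map_zero, hu0]⟩
  obtain ⟨i', b', hne, hu'⟩ := exists_leading_term D hu0
  have hlt : D i' b' < D i b := by
    refine lt_of_le_of_ne (not_lt.1 fun hlt => hne (hw i' b' hlt)) fun he => hne ?_
    obtain ⟨rfl, rfl⟩ := hD.inj _ _ _ _ he
    exact h0
  obtain ⟨q, hq, hqu⟩ := h.exists_standard_representation hD _ u hu hu'
  exact ⟨q, fun l b' hle => hq l b' (hlt.trans_le hle), hqu⟩

theorem IsLeadingFamily.range_linearCombination (hD : IsTermOrder D)
    (h : IsLeadingFamily D U p a c f) :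
    LinearMap.range (Fintype.linearCombination (MvPolynomial (Fin n) R) f) = U := by
  refine le_antisymm ?_ fun u hu => ?_
  · rw [Fintype.range_linearCombination, Submodule.span_le]
    rintro _ ⟨l, rfl⟩
    exact h.mem l
  · by_cases hu0 : u = 0
    · exact hu0 ▸ zero_mem _
    obtain ⟨i, b, -, hu'⟩ := exists_leading_term D hu0
    obtain ⟨q, -, hq⟩ := h.exists_standard_representation hD _ u hu hu'
    exact ⟨q, hq⟩

omit [Fintype ι] [WellFoundedLT W] in
theorem coeff_mul_mem_span_of_syzygy (hD : IsTermOrder D)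
    (hf : ∀ l, f l ∈ termFiltration R D (D (p l) (a l)))
    (hc : ∀ l, coeff (a l) (f l (p l)) = c l) {key : κ → K} (hkey : Function.Injective key)
    {u : κ → MvPolynomial (Fin n) R}
    (hu : Fintype.linearCombination (MvPolynomial (Fin n) R) f u = 0) {k : κ} {b : Fin n →₀ ℕ}
    (hkb : u ∈ termFiltration R (schreyerOrder D p a key) (schreyerOrder D p a key k b)) :
    coeff b (u k) * c k ∈
      Ideal.span (c '' {l | key l < key k ∧ p l = p k ∧ a l ≤ a k + b}) := by
  classical
  have hu' : u ∈ termFiltration R (fun l b => D (p l) (a l + b)) (D (p k) (a k + b)) := by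
    intro l b' hlt
    exact hkb l b' (Prod.Lex.toLex_lt_toLex.2 (Or.inl hlt))
  have hsum := coeff_linearCombination hD hf hc hu'
  rw [hu, Pi.zero_apply, coeff_zero, ← Finset.add_sum_erase _ _ (Finset.mem_univ k),
    if_pos ⟨rfl, le_self_add⟩, add_tsub_cancel_left, eq_comm, add_eq_zero_iff_eq_neg] at hsum
  rw [hsum]
  refine neg_mem (sum_mem fun l hl => ?_)
  split_ifs with h
  · rcases lt_or_ge (key l) (key k) with hlt | hge
    · exact Ideal.mul_mem_left _ _ (Ideal.subset_span ⟨l, ⟨hlt, h⟩, rfl⟩)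
    · rw [hkb l, zero_mul]
      · exact zero_mem _
      · refine Prod.Lex.toLex_lt_toLex.2 (Or.inr ⟨?_, ?_⟩)
        · dsimp only
          rw [add_tsub_cancel_of_le h.2, h.1]
        · exact lt_of_le_of_ne hge fun he => (Finset.mem_erase.1 hl).1 (hkey he.symm)
  · exact zero_mem _

/-- Indices of the leading terms of the syzygies. -/
abbrev SyzygyIndex (p : κ → ι) (key : κ → K) : Type _ :=
  {x : κ × Finset κ // x.2.Nonempty ∧ ∀ l ∈ x.2, key l < key x.1 ∧ p l = p x.1}

/-- The exponent of the leading term of a syzygy. -/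
noncomputable def syzygyExponent (a : κ → Fin n →₀ ℕ) {key : κ → K} (x : SyzygyIndex p key) :
    Fin n →₀ ℕ :=
  x.1.2.sup a - a x.1.1

omit [Fintype ι] [Fintype κ] [WellFoundedLT W] in
theorem syzygyExponent_apply_eq_zero {key : κ → K} (x : SyzygyIndex p key) {v : Fin n}
    (hv : ∀ l ∈ x.1.2, a l v ≤ a x.1.1 v) : syzygyExponent a x v = 0 := by
  rw [syzygyExponent, Finsupp.tsub_apply, tsub_eq_zero_iff_le]
  refine Finset.sup_induction (p := fun y : Fin n →₀ ℕ => y v ≤ a x.1.1 v) ?_ ?_ hv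
  · exact Nat.zero_le _
  · intro y hy z hz
    rw [Finsupp.sup_apply]
    exact sup_le hy hz

theorem IsLeadingFamily.exists_syzygy_leadingFamily [IsPrincipalIdealRing R]
    (hD : IsTermOrder D) (h : IsLeadingFamily D U p a c f) {key : κ → K}
    (hkey : Function.Injective key) :
    ∃ (c' : SyzygyIndex p key → R) (f' : SyzygyIndex p key → κ → MvPolynomial (Fin n) R),
      IsLeadingFamily (schreyerOrder D p a key)
        (LinearMap.ker (Fintype.linearCombination (MvPolynomial (Fin n) R) f))
        (fun x => x.1.1) (syzygyExponent a) c' f' := by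
  classical
  have hgen : ∀ x : SyzygyIndex p key, ∃ e ∈ nonZeroDivisors R,
      ∀ r, r * c x.1.1 ∈ Ideal.span (c '' (x.1.2 : Set κ)) ↔ r ∈ Ideal.span {e} := by
    intro x
    obtain ⟨l, hl⟩ := x.2.1
    have hmem : c l * c x.1.1 ∈ Ideal.span (c '' (x.1.2 : Set κ)) :=
      Ideal.mul_mem_right _ _ (Ideal.subset_span ⟨l, hl, rfl⟩)
    obtain ⟨e, he, heq⟩ := exists_regular_generator
      (Submodule.comap (LinearMap.mulRight R (c x.1.1)) (Ideal.span (c '' (x.1.2 : Set κ))))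
      (x := c l) hmem (h.regular l)
    refine ⟨e, he, fun r => ?_⟩
    rw [← heq]
    rfl
  choose c' hc'reg hc' using hgen
  have hlift : ∀ x : SyzygyIndex p key, ∃ g : κ → MvPolynomial (Fin n) R,
      Fintype.linearCombination (MvPolynomial (Fin n) R) f g = 0 ∧
      g ∈ termFiltration R (schreyerOrder D p a key)
        (schreyerOrder D p a key x.1.1 (syzygyExponent a x)) ∧
      coeff (syzygyExponent a x) (g x.1.1) = c' x := by
    intro x
    have hmem := (hc' x (c' x)).2 (Ideal.mem_span_singleton_self _)
    obtain ⟨r, hr, hrsum⟩ := exists_sum_of_mem_span_image hmem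
    set k := x.1.1 with hk
    set b := syzygyExponent a x with hb
    have hkT : k ∉ x.1.2 := fun hkT => (x.2.2 k hkT).1.false
    have hTle : ∀ l ∈ x.1.2, a l ≤ a k + b := fun l hl =>
      (Finset.le_sup hl).trans le_add_tsub
    set r' : κ → R := Pi.single k (c' x) - r with hr'
    have hr'k : r' k = c' x := by
      simp [hr', hr k hkT]
    have hr'0 : ∀ l, l ≠ k → l ∉ x.1.2 → r' l = 0 := fun l hlk hlT => by
      simp [hr', hlk, hr l hlT]
    have hr'E : ∀ l, l ∉ {l | p l = p k ∧ a l ≤ a k + b} → r' l = 0 := by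
      intro l hl
      refine hr'0 l ?_ fun hlT => hl ⟨(x.2.2 l hlT).2, hTle l hlT⟩
      rintro rfl
      exact hl ⟨rfl, le_self_add⟩
    have hq := monomial_mem_termFiltration (D := D) hr'E
    set g : κ → MvPolynomial (Fin n) R := fun l => monomial (a k + b - a l) (r' l) with hg
    have hπ := linearCombination_mem_termFiltration hD h.le hq
    have hcoeff := coeff_linearCombination hD h.le h.coeff_eq hq
    have hzero : coeff (a k + b)
        (Fintype.linearCombination (MvPolynomial (Fin n) R) f g (p k)) = 0 := by
      have : ∑ l, r' l * c l = 0 := by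
        simp [hr', sub_mul, Finset.sum_sub_distrib, hrsum, Pi.single_apply]
      rw [hcoeff]
      refine Eq.trans ?_ this
      refine Finset.sum_congr rfl fun l _ => ?_
      split_ifs with hl
      · simp [hg]
      · rw [hr'E l hl, zero_mul]
    have hU : Fintype.linearCombination (MvPolynomial (Fin n) R) f g ∈ U := by
      rw [← h.range_linearCombination hD]
      exact ⟨g, rfl⟩
    obtain ⟨q, hq0, hqg⟩ := h.exists_standard_representation_lt hD hU hπ hzero
    refine ⟨g - q, by rw [map_sub, hqg, sub_self], ?_, ?_⟩
    · intro l b' hlt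
      rw [Pi.sub_apply, coeff_sub]
      rcases Prod.Lex.toLex_lt_toLex.1 hlt with hlt | ⟨heq, hlt⟩
      · rw [hq l b' hlt, hq0 l b' hlt.le, sub_zero]
      · rw [hq0 l b' heq.le, sub_zero]
        have : r' l = 0 := by
          refine hr'0 l ?_ fun hlT => hlt.not_gt (x.2.2 l hlT).1
          rintro rfl
          exact hlt.false
        simp [hg, this]
    · rw [Pi.sub_apply, coeff_sub, hq0 k b le_rfl, sub_zero, hg]
      simp [hr'k]
  choose f' hf'0 hf'le hf'c using hlift
  refine ⟨c', f', hf'0, hf'le, hf'c, hc'reg, ?_⟩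
  intro u hu k b hkb
  have hmem := coeff_mul_mem_span_of_syzygy hD h.le h.coeff_eq hkey hu hkb
  set T : Finset κ := Finset.univ.filter fun l => key l < key k ∧ p l = p k ∧ a l ≤ a k + b
    with hTdef
  by_cases hT : T.Nonempty
  · let x : SyzygyIndex p key := ⟨(k, T), hT, fun l hl => by
      have := (Finset.mem_filter.1 hl).2
      exact ⟨this.1, this.2.1⟩⟩
    have hxr : coeff b (u k) ∈ Ideal.span {c' x} := by
      rw [← hc' x]
      simpa [x, hTdef] using hmem
    refine Ideal.span_mono ?_ hxr
    rw [Set.singleton_subset_iff]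
    refine ⟨x, ⟨rfl, ?_⟩, rfl⟩
    rw [syzygyExponent, tsub_le_iff_left]
    exact Finset.sup_le fun l hl => (Finset.mem_filter.1 hl).2.2.2
  · have hempty : {l | key l < key k ∧ p l = p k ∧ a l ≤ a k + b} = ∅ := by
      rw [Finset.not_nonempty_iff_eq_empty] at hT
      simpa [hTdef, Finset.filter_eq_empty_iff, Set.eq_empty_iff_forall_notMem] using hT
    rw [hempty, Set.image_empty, Ideal.span_empty, Ideal.mem_bot] at hmem
    rw [(mul_right_mem_nonZeroDivisors_eq_zero_iff (h.regular k)).1 hmem]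
    exact zero_mem _

omit [Fintype ι] [WellFoundedLT W] in
theorem IsLeadingFamily.ker_linearCombination_eq_bot (hD : IsTermOrder D)
    (h : IsLeadingFamily D U p a c f) (hp : Function.Injective p) :
    LinearMap.ker (Fintype.linearCombination (MvPolynomial (Fin n) R) f) = ⊥ := by
  rw [Submodule.eq_bot_iff]
  intro u hu
  by_contra hu0
  have hkey := (Fintype.equivFin κ).injective
  obtain ⟨k, b, hkb, hu'⟩ := exists_leading_term (schreyerOrder D p a (Fintype.equivFin κ)) hu0
  have hmem := coeff_mul_mem_span_of_syzygy hD h.le h.coeff_eq hkey hu hu'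
  have hempty : {l | Fintype.equivFin κ l < Fintype.equivFin κ k ∧ p l = p k ∧ a l ≤ a k + b} =
      ∅ := by
    rw [Set.eq_empty_iff_forall_notMem]
    rintro l ⟨hlt, hl, -⟩
    exact (hp hl ▸ hlt).false
  rw [hempty, Set.image_empty, Ideal.span_empty, Ideal.mem_bot] at hmem
  exact hkb ((mul_right_mem_nonZeroDivisors_eq_zero_iff (h.regular k)).1 hmem)

omit [Fintype ι] [WellFoundedLT W] in
theorem IsLeadingFamily.exists_of_exponent_eq_zero [IsPrincipalIdealRing R]
    (h : IsLeadingFamily D U p a c f) (ha : ∀ l, a l = 0) :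
    ∃ (c' : Set.range p → R) (f' : Set.range p → ι → MvPolynomial (Fin n) R),
      IsLeadingFamily D U Subtype.val (fun _ => 0) c' f' := by
  have hgen : ∀ i : Set.range p, ∃ g ∈ nonZeroDivisors R,
      Ideal.span (c '' {l | p l = i}) = Ideal.span {g} := by
    rintro ⟨_, l, rfl⟩
    exact exists_regular_generator _ (Ideal.subset_span ⟨l, rfl, rfl⟩) (h.regular l)
  choose c' hc'reg hc' using hgen
  have hlift : ∀ i : Set.range p, ∃ g ∈ U, g ∈ termFiltration R D (D i 0) ∧
      coeff 0 (g i) = c' i := by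
    intro i
    obtain ⟨r, hr, hrsum⟩ := exists_sum_of_mem_span_image
      ((hc' i).symm ▸ Ideal.mem_span_singleton_self (c' i))
    refine ⟨∑ l, (C (r l) : MvPolynomial (Fin n) R) • f l,
      sum_mem fun l _ => Submodule.smul_mem _ _ (h.mem l), ?_, ?_⟩
    · refine sum_mem fun l _ => ?_
      by_cases hl : p l = i
      · intro j b hb
        have := h.le l j b (by rwa [ha, hl])
        simp [this]
      · rw [hr l hl, C_0, zero_smul]
        exact zero_mem _
    · rw [Finset.sum_apply, coeff_sum, ← hrsum]
      refine Finset.sum_congr rfl fun l _ => ?_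
      by_cases hl : p l = i
      · rw [Pi.smul_apply, smul_eq_mul, coeff_C_mul, ← hl, ← h.coeff_eq, ha]
      · simp [hr l hl]
  choose f' hf'U hf'le hf'c using hlift
  refine ⟨c', f', hf'U, hf'le, hf'c, hc'reg, fun u hu i b hib => ?_⟩
  have hmem := h.gen u hu i b hib
  simp only [ha, zero_le, and_true] at hmem ⊢
  by_cases hi : i ∈ Set.range p
  · have : {l : Set.range p | (l : ι) = i} = {⟨i, hi⟩} := by
      ext l
      simp [Subtype.ext_iff]
    rw [this, Set.image_singleton, ← hc']
    exact hmem
  · have : {l | p l = i} = ∅ := Set.eq_empty_iff_forall_notMem.2 fun l hl => hi ⟨l, hl⟩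
    rw [this, Set.image_empty, Ideal.span_empty, Ideal.mem_bot] at hmem
    rw [hmem]
    exact zero_mem _

end Syzygy

universe v

theorem IsLeadingFamily.hasFiniteFreeResolutionOfLength [IsPrincipalIdealRing R] (q : ℕ) :
    ∀ {ι κ : Type} [Fintype ι] [Fintype κ] {W : Type v} [LinearOrder W] [WellFoundedLT W]
      {D : ι → (Fin n →₀ ℕ) → W} (_ : IsTermOrder D)
      {U : Submodule (MvPolynomial (Fin n) R) (ι → MvPolynomial (Fin n) R)}
      {p : κ → ι} {a : κ → Fin n →₀ ℕ} {c : κ → R} {f : κ → ι → MvPolynomial (Fin n) R}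
      (_ : IsLeadingFamily D U p a c f) (_ : ∀ l v, v.val + q < n → a l v = 0),
      HasFiniteFreeResolutionOfLength (MvPolynomial (Fin n) R) U q := by
  classical
  induction q with
  | zero =>
    intro ι κ _ _ W _ _ D hD U p a c f h ha
    have ha' : ∀ l, a l = 0 := fun l => Finsupp.ext fun v => ha l v v.isLt
    obtain ⟨c', f', h'⟩ := h.exists_of_exponent_eq_zero ha'
    have hker := h'.ker_linearCombination_eq_bot hD Subtype.val_injective
    have hrange := h'.range_linearCombination hD
    exact HasFiniteFreeResolutionOfLength.of_linearEquiv
      ((LinearEquiv.funCongrLeft _ _ (Fintype.equivFin _)).trans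
        ((LinearEquiv.ofInjective _ (LinearMap.ker_eq_bot.1 hker)).trans
          (LinearEquiv.ofEq _ _ hrange)))
  | succ q ih =>
    intro ι κ _ _ W _ _ D hD U p a c f h ha
    obtain ⟨s, hs⟩ : ∃ s : κ → ℕ, ∀ l (v : Fin n), v.val + q + 1 = n → a l v = s l := by
      by_cases hq : q < n
      · refine ⟨fun l => a l ⟨n - q - 1, by omega⟩, fun l v hv => ?_⟩
        exact congrArg (a l) (Fin.ext (by dsimp only; omega))
      · exact ⟨0, fun l v hv => absurd hv (by omega)⟩
    let key : κ → ℕ ×ₗ Fin (Fintype.card κ) := fun l => toLex (s l, Fintype.equivFin κ l)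
    have hkey : Function.Injective key := fun l l' hl =>
      (Fintype.equivFin κ).injective (Prod.ext_iff.1 (toLex.injective hl)).2
    obtain ⟨c', f', h'⟩ := h.exists_syzygy_leadingFamily hD hkey
    have hker := ih (hD.schreyerOrder p a hkey) h' fun x v hv => by
      refine syzygyExponent_apply_eq_zero x fun l hl => ?_
      rcases lt_or_eq_of_le (Nat.succ_le_of_lt hv) with hv | hv
      · rw [ha l v hv]
        exact Nat.zero_le _
      · rw [hs l v hv, hs _ v hv]
        rcases Prod.Lex.toLex_lt_toLex.1 (x.2.2 l hl).1 with hlt | ⟨heq, -⟩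
        · exact hlt.le
        · exact heq.le
    rw [← h.range_linearCombination hD]
    refine HasFiniteFreeResolutionOfLength.succ_of_fintype
      (LinearMap.surjective_rangeRestrict _) ?_
    rwa [LinearMap.ker_rangeRestrict]

end LeadingFamily

section Ideal

variable {n : ℕ} {R : Type*} [CommRing R] (m : MonomialOrder (Fin n))

theorem isTermOrder_toSyn : IsTermOrder fun (_ : Fin 1) (b : Fin n →₀ ℕ) => m.toSyn b where
  inj i b i' b' h := ⟨Subsingleton.elim _ _, m.toSyn.injective h⟩
  add_lt i b i' b' e h := by
    simp only [map_add]
    gcongr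

theorem toSyn_le_toSyn_mDeg {g : MvPolynomial (Fin n) R} {b : Fin n →₀ ℕ} (hb : coeff b g ≠ 0) :
    m.toSyn b ≤ m.toSyn (mDeg m g) := by
  rw [mDeg, AddEquiv.apply_symm_apply]
  exact Finset.le_sup (f := fun d => m.toSyn d) (mem_support_iff.2 hb)

theorem mDeg_eq {g : MvPolynomial (Fin n) R} {b : Fin n →₀ ℕ} (hb : coeff b g ≠ 0)
    (h : ∀ d, m.toSyn b < m.toSyn d → coeff d g = 0) : mDeg m g = b := by
  refine m.toSyn.injective (le_antisymm ?_ (toSyn_le_toSyn_mDeg m hb))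
  rw [mDeg, AddEquiv.apply_symm_apply]
  exact Finset.sup_le fun d hd => not_lt.1 fun hlt => mem_support_iff.1 hd (h d hlt)

theorem IsGroebnerBasis.isLeadingFamily {I : Ideal (MvPolynomial (Fin n) R)} {k : ℕ}
    {f : Fin k → MvPolynomial (Fin n) R} (hG : IsGroebnerBasis m I f)
    (hreg : ∀ l, mLC m (f l) ∈ nonZeroDivisors R) :
    IsLeadingFamily (fun (_ : Fin 1) b => m.toSyn b)
      (Submodule.comap (LinearMap.proj (0 : Fin 1)) I)
      (fun _ => 0) (fun l => mDeg m (f l)) (fun l => mLC m (f l)) (fun l _ => f l) where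
  mem l := hG.2.1 l
  le l i b hb := by
    by_contra hne
    exact hb.not_ge (toSyn_le_toSyn_mDeg m hne)
  coeff_eq l := rfl
  regular := hreg
  gen u hu i b hub := by
    obtain rfl : i = 0 := Subsingleton.elim _ _
    by_cases h0 : coeff b (u 0) = 0
    · rw [h0]
      exact zero_mem _
    have hdeg := mDeg_eq m h0 (hub 0)
    have hne : u 0 ≠ 0 := by
      rintro h
      exact h0 (by rw [h, coeff_zero])
    have hmem : mLT m (u 0) ∈ Ideal.span (Set.range fun l => mLT m (f l)) := by
      rw [hG.2.2]
      exact Ideal.subset_span ⟨u 0, ⟨hu, hne⟩, rfl⟩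
    obtain ⟨q, hq⟩ := Ideal.mem_span_range_iff_exists_fun.1 hmem
    have hq := congrArg (coeff b) hq
    rw [mLT, mLC, hdeg, coeff_monomial, if_pos rfl, coeff_sum] at hq
    rw [← hq]
    refine sum_mem fun l _ => ?_
    rw [mLT, coeff_mul_monomial']
    split_ifs with hl
    · exact Ideal.mul_mem_left _ _ (Ideal.subset_span ⟨l, ⟨rfl, hl⟩, rfl⟩)
    · exact zero_mem _

theorem IsGroebnerBasis.hasFiniteFreeResolutionOfLength [IsPrincipalIdealRing R]
    {I : Ideal (MvPolynomial (Fin n) R)} {k : ℕ}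
    {f : Fin k → MvPolynomial (Fin n) R} (hG : IsGroebnerBasis m I f)
    (hreg : ∀ l, mLC m (f l) ∈ nonZeroDivisors R) :
    HasFiniteFreeResolutionOfLength (MvPolynomial (Fin n) R) (MvPolynomial (Fin n) R ⧸ I)
      (n + 1) := by
  have h := (hG.isLeadingFamily m hreg).hasFiniteFreeResolutionOfLength n (isTermOrder_toSyn m)
    fun l v hv => absurd hv (by omega)
  refine HasFiniteFreeResolutionOfLength.succ
    (π := I.mkQ ∘ₗ LinearMap.proj (0 : Fin 1)) ?_ ?_
  · exact I.mkQ_surjective.comp fun x => ⟨fun _ => x, rfl⟩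
  · rwa [LinearMap.ker_comp, Submodule.ker_mkQ]

end Ideal

end PaperGB

/-- over a finite product `R = ∏_{i=1}^{t} R_i/N_iR_i` of quotients of
PIDs, if an ideal `I` of `R[x_1,…,x_n]` admits a Gröbner basis all of whose leading
coefficients are nonzerodivisors, then `S/I` has a finite free resolution of length
at most `n+1`. -/
theorem finite_free_resolution_of_regular_groebnerBasis_finite_product
    {n t : ℕ} (Rr : Fin t → Type*) [∀ i, CommRing (Rr i)] [∀ i, IsDomain (Rr i)]
    [∀ i, IsPrincipalIdealRing (Rr i)]
    (Nn : ∀ i, Rr i) (hNu : ∀ i, ¬ IsUnit (Nn i))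
    (m : MonomialOrder (Fin n))
    (I : Ideal (MvPolynomial (Fin n) (∀ i, Rr i ⧸ Ideal.span {Nn i})))
    {M : ℕ} (f : Fin M → MvPolynomial (Fin n) (∀ i, Rr i ⧸ Ideal.span {Nn i}))
    (hG : IsGroebnerBasis m I f)
    (hreg : ∀ i, mLC m (f i) ∈ nonZeroDivisors (∀ i, Rr i ⧸ Ideal.span {Nn i})) :
    ∃ p ≤ n + 1, HasFiniteFreeResolutionOfLength
      (MvPolynomial (Fin n) (∀ i, Rr i ⧸ Ideal.span {Nn i}))
      (MvPolynomial (Fin n) (∀ i, Rr i ⧸ Ideal.span {Nn i}) ⧸ I) p := by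
  have : ∀ i, IsPrincipalIdealRing (Rr i ⧸ Ideal.span {Nn i}) := fun i =>
    IsPrincipalIdealRing.of_surjective (Ideal.Quotient.mk _) Ideal.Quotient.mk_surjective
  exact ⟨n + 1, le_rfl, hG.hasFiniteFreeResolutionOfLength m hreg⟩
end

section
/- (Hilbert's syzygy theorem for infinite direct products.) Let R = ∏_{i∈A} R_i/N_iR_i, where A is an index set, each R_i is a principal ideal domain, and each N_i ∈ R_i is not a unit (N_i may be zero). Let S = R[x_1,…,x_n] with a fixed monomial order, and let I be an ideal of S such that the ideal LT(I) generated by the leading terms of the nonzero elements of I is finitely generated. Then there exist p ≤ n+1 and finitely generated free S-modules F_0,…,F_p together with an exact sequence ⋯ → F_p → F_p → F_p → F_{p−1} → ⋯ → F_1 → F_0 → S/I → 0; that is, an infinite free resolution (G_i)_{i≥0} of S/I by finitely generated free S-modules with G_i = F_i for 0 ≤ i ≤ p and G_i = F_p for all i ≥ p. -/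
open MvPolynomial
open scoped MonomialOrder

open PaperGB

namespace SchreyerResolution

section TermOrder

variable {n r k : ℕ} {R : Type*} [CommRing R] {W : Type*} [LinearOrder W]

/-- The vectors of polynomials all of whose terms have weight at most `τ`. -/
def degLE (R : Type*) [CommRing R] (w : (Fin n →₀ ℕ) → Fin r → W) (τ : W) :
    Submodule R (Fin r → MvPolynomial (Fin n) R) where
  carrier := {f | ∀ j α, coeff α (f j) ≠ 0 → w α j ≤ τ}
  zero_mem' := by intro j α h; simp at h
  add_mem' := by
    intro f g hf hg j α h
    by_cases hfa : coeff α (f j) = 0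
    · refine hg j α fun hga => h ?_
      simp [hfa, hga]
    · exact hf j α hfa
  smul_mem' := by
    intro a f hf j α h
    refine hf j α fun hfa => h ?_
    simp [hfa]

/-- The vectors of polynomials all of whose terms have weight less than `τ`. -/
def degLT (R : Type*) [CommRing R] (w : (Fin n →₀ ℕ) → Fin r → W) (τ : W) :
    Submodule R (Fin r → MvPolynomial (Fin n) R) where
  carrier := {f | ∀ j α, coeff α (f j) ≠ 0 → w α j < τ}
  zero_mem' := by intro j α h; simp at h
  add_mem' := by
    intro f g hf hg j α h
    by_cases hfa : coeff α (f j) = 0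
    · refine hg j α fun hga => h ?_
      simp [hfa, hga]
    · exact hf j α hfa
  smul_mem' := by
    intro a f hf j α h
    refine hf j α fun hfa => h ?_
    simp [hfa]

variable {w : (Fin n →₀ ℕ) → Fin r → W} {τ : W} {f : Fin r → MvPolynomial (Fin n) R}

theorem degLT_le_degLE : degLT R w τ ≤ degLE R w τ := fun _ hf j α h => (hf j α h).le

theorem mem_degLT_of_mem_degLE {τ' : W} (hf : f ∈ degLE R w τ) (h : τ < τ') :
    f ∈ degLT R w τ' := fun j α hc => (hf j α hc).trans_lt h

theorem exists_leading_term (w : (Fin n →₀ ℕ) → Fin r → W) (hf : f ≠ 0) :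
    ∃ α j, coeff α (f j) ≠ 0 ∧ f ∈ degLE R w (w α j) := by
  classical
  have hne : (Finset.univ.sigma fun j => (f j).support).Nonempty := by
    obtain ⟨j, hj⟩ := Function.ne_iff.1 hf
    obtain ⟨α, hα⟩ := MvPolynomial.ne_zero_iff.1 hj
    exact ⟨⟨j, α⟩, by simpa using hα⟩
  obtain ⟨⟨j, α⟩, hmem, hmax⟩ := Finset.exists_max_image _ (fun x => w x.2 x.1) hne
  refine ⟨α, j, by simpa using hmem, fun j' α' h => hmax ⟨j', α'⟩ (by simpa using h)⟩

/-- `w` orders the terms of a free module compatibly with multiplication by monomials. -/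
structure IsTermOrder (w : (Fin n →₀ ℕ) → Fin r → W) : Prop where
  inj : ∀ {α β i j}, w α i = w β j → α = β ∧ i = j
  add_lt : ∀ {α β i j} (γ), w α i < w β j → w (γ + α) i < w (γ + β) j

theorem IsTermOrder.add_le (hw : IsTermOrder w) {α β : Fin n →₀ ℕ} {i j : Fin r}
    (γ : Fin n →₀ ℕ) (h : w α i ≤ w β j) : w (γ + α) i ≤ w (γ + β) j := by
  rcases h.lt_or_eq with h | h
  · exact (hw.add_lt γ h).le
  · obtain ⟨rfl, rfl⟩ := hw.inj h
    exact le_rfl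

theorem IsTermOrder.mem_degLT (hw : IsTermOrder w) {α : Fin n →₀ ℕ} {j : Fin r}
    (hf : f ∈ degLE R w (w α j)) (h0 : coeff α (f j) = 0) : f ∈ degLT R w (w α j) := by
  intro i β h
  refine (hf i β h).lt_of_ne fun he => h ?_
  obtain ⟨rfl, rfl⟩ := hw.inj he
  exact h0

theorem IsTermOrder.smul_mem_degLE (hw : IsTermOrder w) {β : Fin n →₀ ℕ} {i : Fin r}
    {p : MvPolynomial (Fin n) R} (hf : f ∈ degLE R w (w β i))
    (hp : ∀ δ, coeff δ p ≠ 0 → w (δ + β) i ≤ τ) : p • f ∈ degLE R w τ := by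
  classical
  intro j α h
  rw [Pi.smul_apply, smul_eq_mul, coeff_mul] at h
  obtain ⟨⟨δ, η⟩, hx, hne⟩ := Finset.exists_ne_zero_of_sum_ne_zero h
  rw [Finset.HasAntidiagonal.mem_antidiagonal] at hx
  dsimp only at hx hne
  rw [← hx]
  exact (hw.add_le δ (hf j η (right_ne_zero_of_mul hne))).trans
    (hp δ (left_ne_zero_of_mul hne))

theorem IsTermOrder.coeff_mul_eq (hw : IsTermOrder w) {β ε : Fin n →₀ ℕ} {i j : Fin r}
    {p : MvPolynomial (Fin n) R} (hf : f ∈ degLE R w (w β i))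
    (hp : ∀ δ, coeff δ p ≠ 0 → w (δ + β) i ≤ w ε j) :
    coeff ε (p * f j) = if i = j ∧ β ≤ ε then coeff (ε - β) p * coeff β (f i) else 0 := by
  classical
  have key : ∀ x ∈ Finset.HasAntidiagonal.antidiagonal ε, coeff x.1 p * coeff x.2 (f j) ≠ 0 →
      i = j ∧ x.2 = β := by
    rintro ⟨δ, η⟩ hx hne
    rw [Finset.HasAntidiagonal.mem_antidiagonal] at hx
    dsimp only at hx hne ⊢
    have h1 := hf j η (right_ne_zero_of_mul hne)
    have h2 := hp δ (left_ne_zero_of_mul hne)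
    have h3 := hw.add_le δ h1
    rw [hx] at h3
    obtain ⟨h4, h5⟩ := hw.inj (h2.antisymm h3)
    rw [← hx] at h4
    exact ⟨h5, (add_left_cancel h4).symm⟩
  rw [coeff_mul]
  split_ifs with h
  · obtain ⟨rfl, hβ⟩ := h
    refine Finset.sum_eq_single_of_mem (ε - β, β) ?_ ?_
    · rw [Finset.HasAntidiagonal.mem_antidiagonal]
      exact tsub_add_cancel_of_le hβ
    · rintro ⟨δ, η⟩ hx hne
      by_contra h0
      obtain ⟨-, h2⟩ := key _ hx h0
      rw [Finset.HasAntidiagonal.mem_antidiagonal] at hx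
      dsimp only at hx h2
      subst h2
      exact hne (by rw [← hx, add_tsub_cancel_right])
  · refine Finset.sum_eq_zero fun x hx => ?_
    by_contra h0
    obtain ⟨h1, h2⟩ := key _ hx h0
    rw [Finset.HasAntidiagonal.mem_antidiagonal] at hx
    exact h ⟨h1, by rw [← hx, ← h2]; exact le_add_self⟩

/-- `c` is the coefficient at the term `x^α e_j` of an element of `K` all of whose terms are at
most `x^α e_j`. -/
def IsLeadCoeff (w : (Fin n →₀ ℕ) → Fin r → W)
    (K : Submodule (MvPolynomial (Fin n) R) (Fin r → MvPolynomial (Fin n) R))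
    (α : Fin n →₀ ℕ) (j : Fin r) (c : R) : Prop :=
  ∃ f ∈ K, f ∈ degLE R w (w α j) ∧ coeff α (f j) = c

/-- The terms `c_l x^{β_l} e_{i_l}` generate the leading term module of `K`. -/
def IsLeadFamily {ι : Type*} (w : (Fin n →₀ ℕ) → Fin r → W)
    (K : Submodule (MvPolynomial (Fin n) R) (Fin r → MvPolynomial (Fin n) R))
    (i : ι → Fin r) (β : ι → Fin n →₀ ℕ) (c : ι → R) : Prop :=
  ∀ α j a, IsLeadCoeff w K α j a ↔ a ∈ Ideal.span (c '' {l | i l = j ∧ β l ≤ α})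

theorem IsLeadFamily.reindex {ι κ : Type*}
    {K : Submodule (MvPolynomial (Fin n) R) (Fin r → MvPolynomial (Fin n) R)}
    {i : ι → Fin r} {β : ι → Fin n →₀ ℕ} {c : ι → R} (h : IsLeadFamily w K i β c) (e : κ ≃ ι) :
    IsLeadFamily w K (i ∘ e) (β ∘ e) (c ∘ e) := by
  intro α j a
  rw [h α j a, Set.image_comp]
  congr! 3
  ext x
  refine ⟨fun hx => ⟨e.symm x, by simpa using hx, e.apply_symm_apply x⟩, ?_⟩
  rintro ⟨y, hy, rfl⟩
  exact hy

theorem mem_span_image_iff {c : Fin k → R} {s : Set (Fin k)} {a : R} :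
    a ∈ Ideal.span (c '' s) ↔ ∃ b : Fin k → R, (∀ l, l ∉ s → b l = 0) ∧ ∑ l, b l * c l = a := by
  classical
  constructor
  · intro h
    have h' : a ∈ Submodule.span R (c '' (s.toFinset : Set (Fin k))) := by simpa using h
    obtain ⟨b, hb⟩ := Submodule.mem_span_image_finset_iff_exists_fun' R |>.1 h'
    refine ⟨fun l => if l ∈ s then b l else 0, fun l hl => if_neg hl, ?_⟩
    simpa [ite_mul, ← Finset.sum_filter, Set.filter_mem_univ_eq_toFinset] using hb
  · rintro ⟨b, hb, rfl⟩
    refine Ideal.sum_mem _ fun l _ => ?_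
    by_cases hl : l ∈ s
    · exact Ideal.mul_mem_left _ _ (Ideal.subset_span ⟨l, hl, rfl⟩)
    · rw [hb l hl, zero_mul]
      exact Ideal.zero_mem _

/-- The weight on `S^k` induced by a weight on `S^r` and the terms `x^{β_l} e_{i_l}`. -/
noncomputable def pullback (w : (Fin n →₀ ℕ) → Fin r → W) (i : Fin k → Fin r)
    (β : Fin k → Fin n →₀ ℕ) : (Fin n →₀ ℕ) → Fin k → W := fun γ l => w (γ + β l) (i l)

/-- Schreyer's order: the pulled back weight, ties being broken by the position. -/
noncomputable def schreyer (w : (Fin n →₀ ℕ) → Fin r → W) (i : Fin k → Fin r)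
    (β : Fin k → Fin n →₀ ℕ) : (Fin n →₀ ℕ) → Fin k → W ×ₗ Fin k :=
  fun γ l => toLex (pullback w i β γ l, l)

variable {i : Fin k → Fin r} {β : Fin k → Fin n →₀ ℕ}

theorem IsTermOrder.schreyer (hw : IsTermOrder w) : IsTermOrder (schreyer w i β) where
  inj := by
    intro α α' l l' h
    have h' := congrArg ofLex h
    simp only [SchreyerResolution.schreyer, ofLex_toLex, Prod.mk.injEq] at h'
    obtain ⟨h1, rfl⟩ := h'
    exact ⟨add_right_cancel (hw.inj h1).1, rfl⟩
  add_lt := by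
    intro α α' l l' γ h
    rw [SchreyerResolution.schreyer, SchreyerResolution.schreyer, Prod.Lex.toLex_lt_toLex] at h ⊢
    simp only [pullback, add_assoc] at h ⊢
    rcases h with h | ⟨h, hl⟩
    · exact Or.inl (hw.add_lt γ h)
    · obtain ⟨h1, h2⟩ := hw.inj h
      exact Or.inr ⟨by rw [h1, h2], hl⟩

section Step

variable {K : Submodule (MvPolynomial (Fin n) R) (Fin r → MvPolynomial (Fin n) R)}
  {c : Fin k → R} {g : Fin k → Fin r → MvPolynomial (Fin n) R}

theorem IsTermOrder.linearCombination_mem_degLE (hw : IsTermOrder w)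
    (hg : ∀ l, g l ∈ degLE R w (w (β l) (i l))) {p : Fin k → MvPolynomial (Fin n) R}
    (hp : p ∈ degLE R (pullback w i β) τ) :
    Fintype.linearCombination (MvPolynomial (Fin n) R) g p ∈ degLE R w τ := by
  rw [Fintype.linearCombination_apply]
  exact Submodule.sum_mem _ fun l _ => hw.smul_mem_degLE (hg l) (hp l)

theorem IsTermOrder.coeff_linearCombination (hw : IsTermOrder w)
    (hg : ∀ l, g l ∈ degLE R w (w (β l) (i l))) (hc : ∀ l, coeff (β l) (g l (i l)) = c l)
    {p : Fin k → MvPolynomial (Fin n) R} {ε : Fin n →₀ ℕ} {j : Fin r}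
    (hp : p ∈ degLE R (pullback w i β) (w ε j)) :
    coeff ε (Fintype.linearCombination (MvPolynomial (Fin n) R) g p j) =
      ∑ l, if i l = j ∧ β l ≤ ε then coeff (ε - β l) (p l) * c l else 0 := by
  rw [Fintype.linearCombination_apply, Finset.sum_apply, coeff_sum]
  refine Finset.sum_congr rfl fun l _ => ?_
  rw [Pi.smul_apply, smul_eq_mul, hw.coeff_mul_eq (hg l) (hp l), hc]

/-- The vector `∑ b_l x^{α - β_l} e_l` has terms of weight at most that of `x^α e_j`. -/
theorem monomials_mem_degLE {b : Fin k → R} {α : Fin n →₀ ℕ} {j : Fin r}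
    (hb : ∀ l, ¬ (i l = j ∧ β l ≤ α) → b l = 0) :
    (fun l => monomial (α - β l) (b l)) ∈ degLE R (pullback w i β) (w α j) := by
  intro l δ h
  rw [coeff_monomial] at h
  split_ifs at h with hδ
  · have hl := not_imp_comm.1 (hb l) h
    rw [← hδ, pullback, tsub_add_cancel_of_le hl.2, hl.1]
  · exact absurd rfl h

theorem IsLeadFamily.exists_reduction (hw : IsTermOrder w) (hK : IsLeadFamily w K i β c)
    (hg : ∀ l, g l ∈ degLE R w (w (β l) (i l))) (hc : ∀ l, coeff (β l) (g l (i l)) = c l)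
    {α : Fin n →₀ ℕ} {j : Fin r} (hfK : f ∈ K) (hf : f ∈ degLE R w (w α j)) :
    ∃ q ∈ degLE R (pullback w i β) (w α j),
      f - Fintype.linearCombination (MvPolynomial (Fin n) R) g q ∈ degLT R w (w α j) := by
  obtain ⟨b, hb, hsum⟩ := mem_span_image_iff.1 ((hK α j _).1 ⟨f, hfK, hf, rfl⟩)
  have hq := monomials_mem_degLE (w := w) hb
  refine ⟨_, hq, hw.mem_degLT (Submodule.sub_mem _ hf (hw.linearCombination_mem_degLE hg hq)) ?_⟩
  rw [Pi.sub_apply, coeff_sub, hw.coeff_linearCombination hg hc hq, ← hsum, sub_eq_zero]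
  refine Finset.sum_congr rfl fun l _ => ?_
  split_ifs with h
  · rw [coeff_monomial, if_pos rfl]
  · rw [hb l h, zero_mul]

theorem linearCombination_mem (hgK : ∀ l, g l ∈ K) (p : Fin k → MvPolynomial (Fin n) R) :
    Fintype.linearCombination (MvPolynomial (Fin n) R) g p ∈ K := by
  rw [Fintype.linearCombination_apply]
  exact Submodule.sum_mem _ fun l _ => K.smul_mem _ (hgK l)

theorem IsLeadFamily.exists_representation [WellFoundedLT W] (hw : IsTermOrder w)
    (hK : IsLeadFamily w K i β c) (hgK : ∀ l, g l ∈ K)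
    (hg : ∀ l, g l ∈ degLE R w (w (β l) (i l))) (hc : ∀ l, coeff (β l) (g l (i l)) = c l)
    (hfK : f ∈ K) (hf : f ∈ degLT R w τ) :
    ∃ p ∈ degLT R (pullback w i β) τ,
      Fintype.linearCombination (MvPolynomial (Fin n) R) g p = f := by
  induction τ using WellFoundedLT.induction generalizing f with
  | ind τ ih =>
    by_cases h0 : f = 0
    · exact ⟨0, Submodule.zero_mem _, by rw [map_zero, h0]⟩
    obtain ⟨α, j, hne, hle⟩ := exists_leading_term w h0
    obtain ⟨q, hq, hlt⟩ := hK.exists_reduction hw hg hc hfK hle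
    have hτ := hf j α hne
    obtain ⟨p, hp, hpf⟩ := ih _ hτ (K.sub_mem hfK (linearCombination_mem hgK q)) hlt
    refine ⟨p + q, Submodule.add_mem _
      (mem_degLT_of_mem_degLE (degLT_le_degLE hp) hτ) (mem_degLT_of_mem_degLE hq hτ), ?_⟩
    rw [map_add, hpf, sub_add_cancel]

theorem IsLeadFamily.range_eq [WellFoundedLT W] (hw : IsTermOrder w)
    (hK : IsLeadFamily w K i β c) (hgK : ∀ l, g l ∈ K)
    (hg : ∀ l, g l ∈ degLE R w (w (β l) (i l))) (hc : ∀ l, coeff (β l) (g l (i l)) = c l) :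
    LinearMap.range (Fintype.linearCombination (MvPolynomial (Fin n) R) g) = K := by
  refine le_antisymm ?_ fun f hfK => ?_
  · rintro _ ⟨p, rfl⟩
    exact linearCombination_mem hgK p
  · by_cases h0 : f = 0
    · rw [h0]
      exact Submodule.zero_mem _
    obtain ⟨α, j, -, hle⟩ := exists_leading_term w h0
    obtain ⟨q, -, hlt⟩ := hK.exists_reduction hw hg hc hfK hle
    obtain ⟨p, -, hp⟩ := hK.exists_representation hw hgK hg hc
      (K.sub_mem hfK (linearCombination_mem hgK q)) hlt
    exact ⟨p + q, by rw [map_add, hp, sub_add_cancel]⟩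

theorem IsLeadFamily.isLeadCoeff_ker_iff [WellFoundedLT W] (hw : IsTermOrder w)
    (hK : IsLeadFamily w K i β c) (hgK : ∀ l, g l ∈ K)
    (hg : ∀ l, g l ∈ degLE R w (w (β l) (i l))) (hc : ∀ l, coeff (β l) (g l (i l)) = c l)
    (γ : Fin n →₀ ℕ) (l : Fin k) (a : R) :
    IsLeadCoeff (schreyer w i β)
      (LinearMap.ker (Fintype.linearCombination (MvPolynomial (Fin n) R) g)) γ l a ↔
      a * c l ∈ Ideal.span (c '' {l' | l' < l ∧ i l' = i l ∧ β l' ≤ γ + β l}) := by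
  constructor
  · rintro ⟨p, hpK, hp, rfl⟩
    have hp' : p ∈ degLE R (pullback w i β) (w (γ + β l) (i l)) := fun l' δ h =>
      Prod.Lex.monotone_fst _ _ (hp l' δ h)
    have h0 := hw.coeff_linearCombination hg hc hp'
    rw [LinearMap.mem_ker.1 hpK, Pi.zero_apply, coeff_zero,
      ← Finset.add_sum_erase _ _ (Finset.mem_univ l), if_pos ⟨rfl, le_add_self⟩,
      add_tsub_cancel_right, eq_comm, add_eq_zero_iff_eq_neg] at h0
    rw [h0]
    refine Ideal.neg_mem_iff _ |>.2 (Ideal.sum_mem _ fun l' hl' => ?_)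
    split_ifs with h
    · by_cases hz : coeff (γ + β l - β l') (p l') = 0
      · rw [hz, zero_mul]
        exact Ideal.zero_mem _
      · have hle := hp l' _ hz
        rw [schreyer, schreyer, Prod.Lex.toLex_le_toLex] at hle
        simp only [pullback, tsub_add_cancel_of_le h.2, h.1, lt_irrefl, false_or, true_and] at hle
        exact Ideal.mul_mem_left _ _ (Ideal.subset_span
          ⟨l', ⟨hle.lt_of_ne (Finset.ne_of_mem_erase hl'), h⟩, rfl⟩)
    · exact Ideal.zero_mem _
  · intro ha
    obtain ⟨b, hb, hsum⟩ := mem_span_image_iff.1 ha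
    have hlb : b l = 0 := hb l fun h => lt_irrefl _ h.1
    set b' : Fin k → R := fun l' => if l' = l then a else - b l' with hb'
    have hb0 : ∀ l', ¬ (i l' = i l ∧ β l' ≤ γ + β l) → b' l' = 0 := by
      intro l' h
      have hne : l' ≠ l := by
        rintro rfl
        exact h ⟨rfl, le_add_self⟩
      simp only [hb', if_neg hne]
      rw [hb l' fun h' => h h'.2, neg_zero]
    set q : Fin k → MvPolynomial (Fin n) R := fun l' => monomial (γ + β l - β l') (b' l') with hqd
    have hq : q ∈ degLE R (pullback w i β) (w (γ + β l) (i l)) := monomials_mem_degLE hb0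
    have hq' : q ∈ degLE R (schreyer w i β) (schreyer w i β γ l) := by
      intro l' δ h
      have hle := hq l' δ h
      rw [schreyer, schreyer, Prod.Lex.toLex_le_toLex]
      rcases hle.lt_or_eq with hlt | heq
      · exact Or.inl hlt
      · refine Or.inr ⟨heq, ?_⟩
        by_contra hl
        have hbl : b' l' = 0 := by
          simp only [hb', if_neg (not_le.1 hl).ne']
          rw [hb l' fun h' => hl h'.1.le, neg_zero]
        simp [hqd, hbl] at h
    have hlt : Fintype.linearCombination (MvPolynomial (Fin n) R) g q ∈
        degLT R w (w (γ + β l) (i l)) := by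
      refine hw.mem_degLT (hw.linearCombination_mem_degLE hg hq) ?_
      rw [hw.coeff_linearCombination hg hc hq]
      have : ∀ l', (if i l' = i l ∧ β l' ≤ γ + β l
          then coeff (γ + β l - β l') (q l') * c l' else 0) = b' l' * c l' := by
        intro l'
        split_ifs with h
        · simp [hqd]
        · rw [hb0 l' h, zero_mul]
      simp only [this]
      rw [← Finset.add_sum_erase _ _ (Finset.mem_univ l)]
      rw [← Finset.add_sum_erase _ _ (Finset.mem_univ l), hlb, zero_mul, zero_add] at hsum
      have h2 : ∑ x ∈ Finset.univ.erase l, b' x * c x =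
          - ∑ x ∈ Finset.univ.erase l, b x * c x := by
        rw [← Finset.sum_neg_distrib]
        refine Finset.sum_congr rfl fun x hx => ?_
        simp only [hb', if_neg (Finset.ne_of_mem_erase hx), neg_mul]
      rw [h2, hsum]
      simp [hb']
    obtain ⟨p, hp, hpq⟩ := hK.exists_representation hw hgK hg hc (linearCombination_mem hgK q) hlt
    refine ⟨q - p, ?_, Submodule.sub_mem _ hq' fun l' δ h => ?_, ?_⟩
    · rw [LinearMap.mem_ker, map_sub, hpq, sub_self]
    · rw [schreyer, schreyer, Prod.Lex.toLex_le_toLex]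
      exact Or.inl (hp l' δ h)
    · have hp0 : coeff γ (p l) = 0 := by
        by_contra h
        exact lt_irrefl _ (hp l γ h)
      rw [Pi.sub_apply, coeff_sub, hp0, sub_zero]
      simp [hqd, hb']

/-- One step of Schreyer's construction. -/
theorem IsLeadFamily.exists_presentation [WellFoundedLT W] (hw : IsTermOrder w)
    (hK : IsLeadFamily w K i β c) :
    ∃ φ : (Fin k → MvPolynomial (Fin n) R) →ₗ[MvPolynomial (Fin n) R]
        (Fin r → MvPolynomial (Fin n) R),
      LinearMap.range φ = K ∧ ∀ γ l a,
        IsLeadCoeff (schreyer w i β) (LinearMap.ker φ) γ l a ↔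
          a * c l ∈ Ideal.span (c '' {l' | l' < l ∧ i l' = i l ∧ β l' ≤ γ + β l}) := by
  have h : ∀ l, IsLeadCoeff w K (β l) (i l) (c l) := fun l =>
    (hK _ _ _).2 (Ideal.subset_span ⟨l, ⟨rfl, le_rfl⟩, rfl⟩)
  choose g hgK hg hc using h
  exact ⟨_, hK.range_eq hw hgK hg hc, hK.isLeadCoeff_ker_iff hw hgK hg hc⟩

end Step

end TermOrder

section Coefficients

/-- The quotient of a finitely generated ideal by an element is principal. -/
def ColonPrincipal (R : Type*) [CommRing R] : Prop :=
  ∀ (k : ℕ) (c : Fin k → R) (s : Set (Fin k)) (d : R),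
    ∃ e : R, ∀ a, a * d ∈ Ideal.span (c '' s) ↔ a ∈ Ideal.span {e}

variable {A : Type*} {P : A → Type*} [∀ i, CommRing (P i)]

theorem mem_span_image_pi_iff {k : ℕ} {c : Fin k → ∀ i, P i} {s : Set (Fin k)} {a : ∀ i, P i} :
    a ∈ Ideal.span (c '' s) ↔ ∀ i, a i ∈ Ideal.span ((fun l => c l i) '' s) := by
  simp only [mem_span_image_iff]
  constructor
  · rintro ⟨b, hb, rfl⟩ i
    exact ⟨fun l => b l i, fun l hl => congrFun (hb l hl) i, by simp⟩
  · intro h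
    choose b hb hsum using h
    refine ⟨fun l i => b i l, fun l hl => funext fun i => hb i l hl, funext fun i => ?_⟩
    simpa using hsum i

theorem colonPrincipal_pi [∀ i, IsPrincipalIdealRing (P i)] : ColonPrincipal (∀ i, P i) := by
  intro k c s d
  have h : ∀ i, ∃ e : P i, ∀ a, a * d i ∈ Ideal.span ((fun l => c l i) '' s) ↔ e ∣ a := by
    intro i
    let J : Ideal (P i) := Submodule.comap (LinearMap.mulRight (P i) (d i))
      (Ideal.span ((fun l => c l i) '' s))
    obtain ⟨e, he⟩ := (IsPrincipalIdealRing.principal J).principal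
    refine ⟨e, fun a => ?_⟩
    rw [← Ideal.mem_span_singleton]
    exact (SetLike.ext_iff.1 he a :)
  choose e he using h
  refine ⟨e, fun a => ?_⟩
  rw [mem_span_image_pi_iff, Ideal.mem_span_singleton, pi_dvd_iff]
  exact forall_congr' fun i => he i (a i)

end Coefficients

section Induction

variable {n r k : ℕ} {R : Type*} [CommRing R]

theorem ColonPrincipal.exists_leadFamily (hR : ColonPrincipal R) {W : Type*} [LinearOrder W]
    {w : (Fin n →₀ ℕ) → Fin k → W}
    {K : Submodule (MvPolynomial (Fin n) R) (Fin k → MvPolynomial (Fin n) R)}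
    {i : Fin k → Fin r} {β : Fin k → Fin n →₀ ℕ} {c : Fin k → R}
    (hK : ∀ γ l a, IsLeadCoeff w K γ l a ↔
      a * c l ∈ Ideal.span (c '' {l' | l' < l ∧ i l' = i l ∧ β l' ≤ γ + β l})) :
    ∃ (T : Fin k × Finset (Fin k) → Finset (Fin k)) (d : Fin k × Finset (Fin k) → R),
      (∀ x, ∀ l ∈ T x, l < x.1) ∧
      IsLeadFamily w K Prod.fst (fun x => (T x).sup fun l => β l - β x.1) d := by
  classical
  set T : Fin k × Finset (Fin k) → Finset (Fin k) :=
    fun x => x.2.filter fun l => l < x.1 ∧ i l = i x.1 with hT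
  choose d hd using fun x : Fin k × Finset (Fin k) => hR k c (T x) (c x.1)
  refine ⟨T, d, fun x l hl => (Finset.mem_filter.1 hl).2.1, fun γ l a => ?_⟩
  rw [hK]
  constructor
  · intro h
    have hx : (T (l, Finset.univ.filter fun l' => β l' ≤ γ + β l) : Set (Fin k)) =
        {l' | l' < l ∧ i l' = i l ∧ β l' ≤ γ + β l} := by
      ext l'
      simp only [hT, Finset.coe_filter, Finset.mem_filter, Finset.mem_univ, Set.mem_ofPred_eq]
      tauto
    rw [← hx] at h
    have h' := (hd (l, _) a).1 h
    have hmem : (l, Finset.univ.filter fun l' => β l' ≤ γ + β l) ∈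
        {x | x.1 = l ∧ ((T x).sup fun l' => β l' - β x.1) ≤ γ} := by
      refine ⟨rfl, Finset.sup_le fun l' hl' => ?_⟩
      rw [tsub_le_iff_right]
      rw [← Finset.mem_coe, hx] at hl'
      exact hl'.2.2
    exact Ideal.span_mono (Set.singleton_subset_iff.2 (Set.mem_image_of_mem d hmem)) h'
  · have hsub : Ideal.span (d '' {x | x.1 = l ∧ ((T x).sup fun l' => β l' - β x.1) ≤ γ}) ≤
        Submodule.comap (LinearMap.mulRight R (c l))
          (Ideal.span (c '' {l' | l' < l ∧ i l' = i l ∧ β l' ≤ γ + β l})) := by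
      rw [Ideal.span_le]
      rintro _ ⟨x, ⟨rfl, hx⟩, rfl⟩
      have h' := (hd x (d x)).2 (Ideal.mem_span_singleton_self _)
      refine Ideal.span_mono (Set.image_mono fun l' hl' => ?_) h'
      have hl := Finset.mem_filter.1 hl'
      exact ⟨hl.2.1, hl.2.2, tsub_le_iff_right.1 ((Finset.le_sup hl').trans hx)⟩
    exact fun h => hsub h

/-- The submodule `K` of a finite free module admits a term order for which its leading term
module is generated by finitely many terms not involving the first `s` variables. -/
def IsGood.{u} (s : ℕ) {r : ℕ}
    (K : Submodule (MvPolynomial (Fin n) R) (Fin r → MvPolynomial (Fin n) R)) : Prop :=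
  ∃ (W : Type u) (_ : LinearOrder W) (_ : WellFoundedLT W) (w : (Fin n →₀ ℕ) → Fin r → W),
    IsTermOrder w ∧ ∃ (k : ℕ) (i : Fin k → Fin r) (β : Fin k → Fin n →₀ ℕ) (c : Fin k → R),
      (∀ l t, t.val < s → β l t = 0) ∧ IsLeadFamily w K i β c

theorem isGood_of_family.{u} {s : ℕ} {W : Type u} [LinearOrder W] [WellFoundedLT W]
    {K : Submodule (MvPolynomial (Fin n) R) (Fin r → MvPolynomial (Fin n) R)}
    {w : (Fin n →₀ ℕ) → Fin r → W} (hw : IsTermOrder w) {ι : Type*} [Finite ι]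
    {i : ι → Fin r} {β : ι → Fin n →₀ ℕ} {c : ι → R} (hβ : ∀ l t, t.val < s → β l t = 0)
    (h : IsLeadFamily w K i β c) : IsGood.{_, u} s K :=
  ⟨W, _, ‹_›, w, hw, Nat.card ι, _, _, _, fun _ _ ht => hβ _ _ ht,
    h.reindex (Finite.equivFin ι).symm⟩

theorem IsGood.exists_presentation_of_lt.{u} (hR : ColonPrincipal R) {s : ℕ} (hs : s < n)
    {K : Submodule (MvPolynomial (Fin n) R) (Fin r → MvPolynomial (Fin n) R)}
    (hK : IsGood.{_, u} s K) :
    ∃ (k : ℕ) (φ : (Fin k → MvPolynomial (Fin n) R) →ₗ[MvPolynomial (Fin n) R]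
        (Fin r → MvPolynomial (Fin n) R)),
      LinearMap.range φ = K ∧ IsGood.{_, u} (s + 1) (LinearMap.ker φ) := by
  obtain ⟨W, _, _, w, hw, k, i₀, β₀, c₀, hβ₀, hfam₀⟩ := hK
  set e := Tuple.sort fun l => β₀ l ⟨s, hs⟩
  have hmono : Monotone fun l => β₀ (e l) ⟨s, hs⟩ :=
    Tuple.monotone_sort fun l => β₀ l ⟨s, hs⟩
  obtain ⟨φ, hφ, hker⟩ := (hfam₀.reindex e).exists_presentation hw
  obtain ⟨T, c', hT, hfam⟩ := hR.exists_leadFamily hker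
  refine ⟨k, φ, hφ, isGood_of_family hw.schreyer (fun x t ht => ?_) hfam⟩
  refine Finset.sup_induction (p := fun v : Fin n →₀ ℕ => v t = 0) rfl ?_ fun l hl => ?_
  · intro a ha b hb
    rw [Finsupp.sup_apply, ha, hb, sup_idem]
  · rw [Finsupp.tsub_apply]
    rcases Nat.lt_succ_iff_lt_or_eq.1 ht with ht | ht
    · rw [Function.comp_apply, hβ₀ _ _ ht, zero_tsub]
    · obtain rfl : t = ⟨s, hs⟩ := Fin.ext ht
      exact tsub_eq_zero_of_le (hmono (hT x l hl).le)

theorem IsGood.exists_presentation_of_le.{u} (hR : ColonPrincipal R) {s : ℕ} (hs : n ≤ s)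
    {K : Submodule (MvPolynomial (Fin n) R) (Fin r → MvPolynomial (Fin n) R)}
    (hK : IsGood.{_, u} s K) :
    ∃ φ : (Fin r → MvPolynomial (Fin n) R) →ₗ[MvPolynomial (Fin n) R]
        (Fin r → MvPolynomial (Fin n) R),
      LinearMap.range φ = K ∧ IsGood.{_, u} (s + 1) (LinearMap.ker φ) := by
  obtain ⟨W, _, _, w, hw, k, i, β, c, hβ, hfam⟩ := hK
  choose c' hc' using fun j : Fin r => hR k c {l | i l = j} 1
  have hfam' : IsLeadFamily w K id (0 : Fin r → Fin n →₀ ℕ) c' := by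
    intro α j a
    have hβ0 : ∀ l, β l = 0 := fun l => Finsupp.ext fun t => hβ l t (t.2.trans_le hs)
    have h := hc' j a
    rw [mul_one] at h
    rw [hfam]
    simpa [hβ0] using h
  obtain ⟨φ, hφ, hker⟩ := hfam'.exists_presentation hw
  obtain ⟨T, c', -, hfam⟩ := hR.exists_leadFamily hker
  refine ⟨φ, hφ, isGood_of_family hw.schreyer (fun x t _ => ?_) hfam⟩
  refine Finset.sup_induction (p := fun v : Fin n →₀ ℕ => v t = 0) rfl ?_ fun l _ => ?_
  · intro a ha b hb
    rw [Finsupp.sup_apply, ha, hb, sup_idem]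
  · simp

theorem IsGood.exists_presentation.{u} (hR : ColonPrincipal R) {s : ℕ}
    {K : Submodule (MvPolynomial (Fin n) R) (Fin r → MvPolynomial (Fin n) R)}
    (hK : IsGood.{_, u} s K) :
    ∃ (k : ℕ) (φ : (Fin k → MvPolynomial (Fin n) R) →ₗ[MvPolynomial (Fin n) R]
        (Fin r → MvPolynomial (Fin n) R)),
      LinearMap.range φ = K ∧ IsGood.{_, u} (s + 1) (LinearMap.ker φ) ∧ (n ≤ s → k = r) := by
  rcases lt_or_ge s n with hs | hs
  · obtain ⟨k, φ, h1, h2⟩ := hK.exists_presentation_of_lt hR hs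
    exact ⟨k, φ, h1, h2, fun h => absurd hs h.not_gt⟩
  · obtain ⟨φ, h1, h2⟩ := hK.exists_presentation_of_le hR hs
    exact ⟨r, φ, h1, h2, fun _ => rfl⟩

theorem IsGood.hasEventuallyConstantFreeResolution.{u} (hR : ColonPrincipal R)
    {M : Type*} [AddCommGroup M] [Module (MvPolynomial (Fin n) R) M]
    {ε : (Fin r → MvPolynomial (Fin n) R) →ₗ[MvPolynomial (Fin n) R] M}
    (hε : Function.Surjective ε) (hK : IsGood.{_, u} 0 (LinearMap.ker ε)) :
    HasEventuallyConstantFreeResolution (MvPolynomial (Fin n) R) M n := by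
  let State (s : ℕ) := {x : Σ r : ℕ, Submodule (MvPolynomial (Fin n) R)
    (Fin r → MvPolynomial (Fin n) R) // IsGood.{_, u} s x.2}
  choose k φ hφ hgood hk using fun (s : ℕ) (x : State s) => x.2.exists_presentation hR
  let x : ∀ s, State s := fun s => Nat.rec ⟨⟨r, LinearMap.ker ε⟩, hK⟩
    (fun s x => ⟨⟨k s x, LinearMap.ker (φ s x)⟩, hgood s x⟩) s
  refine ⟨fun s => (x s).1.1, fun s => φ s (x s), ε, fun i hi => ?_, hε, hφ 0 (x 0),
    fun s => hφ (s + 1) (x (s + 1))⟩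
  induction i, hi using Nat.le_induction with
  | base => rfl
  | succ s hs ih => exact (hk s (x s) hs).trans ih

end Induction

section Ideal

universe v

variable {n : ℕ} {R : Type*} [CommRing R] (m : MonomialOrder.{0, v} (Fin n))

theorem toSyn_le_mDeg {f : MvPolynomial (Fin n) R} {α : Fin n →₀ ℕ} (h : coeff α f ≠ 0) :
    m.toSyn α ≤ m.toSyn (mDeg m f) := by
  rw [mDeg, AddEquiv.apply_symm_apply]
  exact Finset.le_sup (f := fun d => m.toSyn d) (mem_support_iff.2 h)

theorem mDeg_eq {f : MvPolynomial (Fin n) R} {α : Fin n →₀ ℕ} (h : coeff α f ≠ 0)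
    (hle : ∀ β, coeff β f ≠ 0 → m.toSyn β ≤ m.toSyn α) : mDeg m f = α := by
  refine m.toSyn.injective (le_antisymm ?_ (toSyn_le_mDeg m h))
  rw [mDeg, AddEquiv.apply_symm_apply]
  exact Finset.sup_le fun β hβ => hle β (mem_support_iff.1 hβ)

theorem isTermOrder_toSyn : IsTermOrder fun (α : Fin n →₀ ℕ) (_ : Fin 1) => m.toSyn α where
  inj h := ⟨m.toSyn.injective h, Subsingleton.elim _ _⟩
  add_lt γ h := by
    simp only [map_add]
    exact add_lt_add_right h _

theorem exists_leadFamily_of_fg {I : Ideal (MvPolynomial (Fin n) R)} (hLT : (mLTIdeal m I).FG) :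
    ∃ (s : Finset (MvPolynomial (Fin n) R)) (β : s → Fin n →₀ ℕ) (c : s → R),
      IsLeadFamily (fun (α : Fin n →₀ ℕ) (_ : Fin 1) => m.toSyn α)
        (Submodule.comap (LinearMap.proj 0) I) (fun _ => 0) β c := by
  obtain ⟨s, hs, hspan⟩ := (Submodule.fg_span_iff_fg_span_finset_subset _).1 hLT
  choose g hg hgs using fun x : s => hs x.2
  refine ⟨s, fun x => mDeg m (g x), fun x => mLC m (g x), fun α j a => ?_⟩
  rw [Subsingleton.elim j 0]
  constructor
  · rintro ⟨f, hfI, hf, rfl⟩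
    by_cases h0 : coeff α (f 0) = 0
    · rw [h0]
      exact Ideal.zero_mem _
    have hdeg : mDeg m (f 0) = α := mDeg_eq m h0 (hf 0)
    have hmem : monomial α (coeff α (f 0)) ∈ Ideal.span (s : Set (MvPolynomial (Fin n) R)) := by
      rw [Ideal.span, ← hspan]
      refine Ideal.subset_span ⟨f 0, ⟨hfI, fun hz => h0 (by rw [hz, coeff_zero])⟩, ?_⟩
      simp only [mLT, mLC, hdeg]
    obtain ⟨p, hp⟩ := Submodule.mem_span_finset'.1 hmem
    have hc := congrArg (coeff α) hp
    rw [coeff_monomial, if_pos rfl, coeff_sum] at hc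
    rw [← hc]
    refine Ideal.sum_mem _ fun x _ => ?_
    rw [← hgs x, smul_eq_mul]
    simp only [mLT, coeff_mul_monomial']
    split_ifs with h
    · exact Ideal.mul_mem_left _ _ (Ideal.subset_span
        (Set.mem_image_of_mem (fun x => mLC m (g x)) ⟨by simp, h⟩))
    · exact Ideal.zero_mem _
  · intro ha
    refine Submodule.span_induction (p := fun a _ => IsLeadCoeff _ _ α 0 a) ?_ ?_ ?_ ?_ ha
    · rintro _ ⟨x, ⟨-, hx⟩, rfl⟩
      have hgx : (fun _ : Fin 1 => g x) ∈ degLE R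
          (fun (α : Fin n →₀ ℕ) (_ : Fin 1) => m.toSyn α) (m.toSyn (mDeg m (g x))) :=
        fun _ δ h => toSyn_le_mDeg m h
      refine ⟨(monomial (α - mDeg m (g x)) (1 : R)) • fun _ => g x,
        I.mul_mem_left _ (hg x).1, (isTermOrder_toSyn m).smul_mem_degLE (i := 0) hgx ?_, ?_⟩
      · intro δ h
        rw [coeff_monomial] at h
        split_ifs at h with hδ
        · rw [← hδ, tsub_add_cancel_of_le hx]
        · exact absurd rfl h
      · rw [Pi.smul_apply, smul_eq_mul, coeff_monomial_mul', if_pos tsub_le_self, one_mul,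
          tsub_tsub_cancel_of_le hx]
        rfl
    · exact ⟨0, Submodule.zero_mem _, Submodule.zero_mem _, by simp⟩
    · rintro _ _ _ _ ⟨f, hfI, hf, rfl⟩ ⟨f', hfI', hf', rfl⟩
      exact ⟨f + f', Submodule.add_mem _ hfI hfI', Submodule.add_mem _ hf hf', by simp⟩
    · rintro b _ _ ⟨f, hfI, hf, rfl⟩
      refine ⟨b • f, ?_, Submodule.smul_mem _ b hf, by simp⟩
      rw [algebra_compatible_smul (MvPolynomial (Fin n) R) b f]
      exact Submodule.smul_mem _ _ hfI

theorem isGood_of_fg {I : Ideal (MvPolynomial (Fin n) R)} (hLT : (mLTIdeal m I).FG) :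
    IsGood.{_, v} 0 (Submodule.comap (LinearMap.proj (R := MvPolynomial (Fin n) R)
      (φ := fun _ : Fin 1 => MvPolynomial (Fin n) R) 0) I) := by
  obtain ⟨s, β, c, h⟩ := exists_leadFamily_of_fg m hLT
  exact isGood_of_family (isTermOrder_toSyn m) (fun _ t ht => absurd ht t.val.not_lt_zero) h

end Ideal

end SchreyerResolution

/-- Hilbert's syzygy theorem for an arbitrary direct product
`R = ∏_{i∈A} R_i/N_iR_i` of quotients of PIDs: if `I` is an ideal of `R[x_1,…,x_n]`
whose leading term ideal is finitely generated, then `S/I` has an infinite free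
resolution by finitely generated free modules which is constant from stage
`p ≤ n+1` on. -/
theorem hilbert_syzygy_infinite_product
    {n : ℕ} {A : Type*} (Rr : A → Type*) [∀ i, CommRing (Rr i)] [∀ i, IsDomain (Rr i)]
    [∀ i, IsPrincipalIdealRing (Rr i)]
    (Nn : ∀ i, Rr i) (hNu : ∀ i, ¬ IsUnit (Nn i))
    (m : MonomialOrder (Fin n))
    (I : Ideal (MvPolynomial (Fin n) (∀ i, Rr i ⧸ Ideal.span {Nn i})))
    (hLT : (mLTIdeal m I).FG) :
    ∃ p ≤ n + 1, HasEventuallyConstantFreeResolution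
      (MvPolynomial (Fin n) (∀ i, Rr i ⧸ Ideal.span {Nn i}))
      (MvPolynomial (Fin n) (∀ i, Rr i ⧸ Ideal.span {Nn i}) ⧸ I) p := by
  have (i : A) : IsPrincipalIdealRing (Rr i ⧸ Ideal.span {Nn i}) :=
    IsPrincipalIdealRing.of_surjective _ Ideal.Quotient.mk_surjective
  refine ⟨n, n.le_succ, SchreyerResolution.IsGood.hasEventuallyConstantFreeResolution
    SchreyerResolution.colonPrincipal_pi (ε := I.mkQ ∘ₗ LinearMap.proj (0 : Fin 1)) ?_ ?_⟩
  · exact I.mkQ_surjective.comp (LinearMap.proj_surjective 0)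
  · rw [LinearMap.ker_comp, Submodule.ker_mkQ]
    exact SchreyerResolution.isGood_of_fg m hLT
end
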